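/- Let p(x) ∈ ℂ[x] and ℓ ∈ ℂ. There exists a ǧ_p-module V of level ℓ together with a vector 1 ∈ V and a ℂ-linear operator D on V such that: (a) (f(z)u⊗tⁿ)·1 = 0 for all u ∈ g ∪ g¹, f(z) ∈ ℂ((z)) and n ≥ 0; (b) the only ǧ_p-submodule of V containing 1 is V itself; (c) D1 = 0, D(f(z)v) = f'(z)v + f(z)D(v) for all f(z) ∈ ℂ((z)), v ∈ V, and [D, ρ(f(z)u⊗tⁿ)] = ρ(f'(z)u⊗tⁿ) − n·ρ(f(z)u⊗tⁿ⁻¹) for all u ∈ g ∪ g¹, f(z) ∈ ℂ((z)), n ∈ ℤ, where ρ denotes the action; (d) the ℂ((z))-linear map ℂ((z))⊗(g⊕g¹) → V sending f(z)u to ρ(f(z)u⊗t⁻¹)1 is injective; and (e) V is universal: for every ǧ_p-module W of level ℓ and every w₀ ∈ W satisfying (f(z)u⊗tⁿ)·w₀ = 0 for all u ∈ g ∪ g¹, f(z) ∈ ℂ((z)), n ≥ 0, there exists a unique homomorphism of ǧ_p-modules ψ: V → W with ψ(1) = w₀. -/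

import Mathlib

/-!
Statement 15: existence of the universal vacuum module `V_{ǧ_p}(ℓ,0)`: a level-`ℓ`
`ǧ_p`-module generated by a vacuum vector `1` annihilated by all `f(z)u⊗tⁿ` with
`n ≥ 0`, carrying a compatible operator `D`, in which `ℂ((z))⊗(g⊕g¹)` embeds via
`f(z)u ↦ (f(z)u⊗t⁻¹)·1`, and which is universal among level-`ℓ` modules with a
vacuum-like vector.
-/

/-- The formal derivative on `ℂ((z))`. -/
abbrev LSderiv (f : LaurentSeries ℂ) : LaurentSeries ℂ := LaurentSeries.derivative ℂ f

open scoped TensorProduct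

noncomputable section

/-- Scalar actions of `ℂ` and `ℂ((z))` on `ℂ((z))` commute. -/
instance : SMulCommClass ℂ (LaurentSeries ℂ) (LaurentSeries ℂ) where
  smul_comm c f x := by
    change c • (f * x) = f * (c • x)
    rw [← HahnSeries.C_mul_eq_smul, ← HahnSeries.C_mul_eq_smul, mul_left_comm]

/-- The underlying ℂ((z))-vector space of `ǧ_p = (ℂ((z)) ⊗ (g ⊕ g¹) ⊗ ℂ[t,t⁻¹]) ⊕ ℂ((z))k`. -/
abbrev CpSp (g : Type) [AddCommGroup g] [Module ℂ g] : Type :=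
  (ℤ →₀ (LaurentSeries ℂ ⊗[ℂ] (g × g))) × LaurentSeries ℂ

variable {g : Type} [LieRing g] [LieAlgebra ℂ g]

/-- The element `a ⊗ tⁿ` of `ǧ_p` (with `a` in the first copy of `g`). -/
def elCA (a : g) (n : ℤ) : CpSp g :=
  (Finsupp.single n ((1 : LaurentSeries ℂ) ⊗ₜ[ℂ] (a, 0)), 0)

/-- The element `a¹ ⊗ tⁿ` of `ǧ_p` (with `a¹` in the second copy `g¹` of `g`). -/
def elCB (a : g) (n : ℤ) : CpSp g :=
  (Finsupp.single n ((1 : LaurentSeries ℂ) ⊗ₜ[ℂ] (0, a)), 0)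

/-- The central element `k` of `ǧ_p`. -/
def elCK (g : Type) [LieRing g] [LieAlgebra ℂ g] : CpSp g := (0, 1)

/-- The embedding of the polynomial ring `ℂ[z]` into `ℂ((z))` (evaluation at `z`). -/
def polyToL (P : Polynomial ℂ) : LaurentSeries ℂ :=
  Polynomial.aeval (HahnSeries.single (1 : ℤ) (1 : ℂ)) P

/-- `p^{(i)}(z)/i!` as an element of `ℂ((z))`, for `i ∈ ℤ`, interpreted as `0` for `i < 0`. -/
def hDiv (P : Polynomial ℂ) (i : ℤ) : LaurentSeries ℂ :=
  if 0 ≤ i then polyToL (Polynomial.hasseDeriv i.toNat P) else 0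


/-- A `ℂ((z))`-vector space equipped with a `ℂ((z))`-bilinear action of the space
underlying `ǧ_p`. -/
structure CheckRep (g : Type) [LieRing g] [LieAlgebra ℂ g] where
  /-- the underlying space -/
  V : Type
  /-- its additive group structure -/
  [instAdd : AddCommGroup V]
  /-- its `ℂ((z))`-vector space structure -/
  [instMod : Module (LaurentSeries ℂ) V]
  /-- the action map -/
  ρ : CpSp g →ₗ[LaurentSeries ℂ] V →ₗ[LaurentSeries ℂ] V

attribute [instance] CheckRep.instAdd CheckRep.instMod

/-- The action of `ℂ` on such a space, via `ℂ ⊆ ℂ((z))`. -/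
instance (g : Type) [LieRing g] [LieAlgebra ℂ g] (M : CheckRep g) : Module ℂ M.V :=
  Module.compHom M.V (algebraMap ℂ (LaurentSeries ℂ))


set_option linter.unusedSectionVars false

namespace PBW

open Finsupp

section
variable {K G J H : Type} [CommRing K] [AddCommGroup G] [Module K G] [LinearOrder J]

abbrev S (K J : Type) [CommRing K] := Multiset J →₀ K

def mono (K : Type) {J : Type} [CommRing K] (m : Multiset J) : S K J := Finsupp.single m 1

def top (K : Type) {J H : Type} [CommRing K] : J ⊕ H → Multiset J → S K J
  | Sum.inl j, m => mono K (j ::ₘ m)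
  | Sum.inr _, _ => 0

def chi0 (χ : H → K) : J ⊕ H → K
  | Sum.inl _ => 0
  | Sum.inr h => χ h

def QQ (k : J) : J ⊕ H → Prop
  | Sum.inl j => k < j
  | Sum.inr _ => True

def F (K J : Type) [CommRing K] (d : ℕ) : Submodule K (S K J) :=
  Finsupp.supported K K {m | Multiset.card m ≤ d}

def lin (b : Module.Basis (J ⊕ H) K G) (f : J ⊕ H → Multiset J → S K J) :
    G →ₗ[K] S K J →ₗ[K] S K J :=
  b.constr K (fun i => Finsupp.linearCombination K (f i))

lemma lin_apply (b : Module.Basis (J ⊕ H) K G) (f : J ⊕ H → Multiset J → S K J) (i m) :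
    lin b f (b i) (mono K m) = f i m := by
  simp [lin, mono, Module.Basis.constr_basis]

open Classical in
def step (b : Module.Basis (J ⊕ H) K G) (Br : G →ₗ[K] G →ₗ[K] G) (χ : H → K)
    (A : G →ₗ[K] S K J →ₗ[K] S K J) (i : J ⊕ H) (m : Multiset J) : S K J :=
  top K i m +
    match m.sort with
    | [] => chi0 χ i • mono K 0
    | k :: l => if QQ k i then
        A (b (Sum.inl k)) (A (b i) (mono K (l : Multiset J)) - top K i (l : Multiset J))
          + A (Br (b i) (b (Sum.inl k))) (mono K (l : Multiset J))
      else 0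

def act (b : Module.Basis (J ⊕ H) K G) (Br : G →ₗ[K] G →ₗ[K] G) (χ : H → K) :
    ℕ → (G →ₗ[K] S K J →ₗ[K] S K J)
  | 0 => lin b (top K)
  | d + 1 => lin b (step b Br χ (act b Br χ d))

def Act (b : Module.Basis (J ⊕ H) K G) (Br : G →ₗ[K] G →ₗ[K] G) (χ : H → K) :
    G →ₗ[K] S K J →ₗ[K] S K J :=
  lin b (fun i m => act b Br χ (Multiset.card m + 1) (b i) (mono K m))

lemma F_mono {d e : ℕ} (h : d ≤ e) : F K J d ≤ F K J e :=
  Finsupp.supported_mono (fun _ hm => le_trans hm h)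

lemma mono_mem {m : Multiset J} {d : ℕ} (h : Multiset.card m ≤ d) : mono K m ∈ F K J d :=
  Finsupp.single_mem_supported K _ h

lemma top_mem {H : Type} (i : J ⊕ H) {m : Multiset J} {d : ℕ} (h : Multiset.card m + 1 ≤ d) :
    top K i m ∈ F K J d := by
  cases i with
  | inl j => exact mono_mem (by simpa using h)
  | inr _ => exact Submodule.zero_mem _

/-- induction on elements of `F d`. -/
lemma F_le {d : ℕ} {T : Submodule K (S K J)}
    (h : ∀ m : Multiset J, Multiset.card m ≤ d → mono K m ∈ T) : F K J d ≤ T := by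
  rw [F, Finsupp.supported_eq_span_single, Submodule.span_le]
  rintro _ ⟨m, hm, rfl⟩
  exact h m hm

lemma ext_mono {W : Type} [AddCommGroup W] [Module K W] {f g : S K J →ₗ[K] W}
    (h : ∀ m, f (mono K m) = g (mono K m)) : f = g := by
  apply Finsupp.lhom_ext'
  intro m
  ext
  exact h m

def HasDeg (b : Module.Basis (J ⊕ H) K G) (A : G →ₗ[K] S K J →ₗ[K] S K J) : Prop :=
  ∀ i m, A (b i) (mono K m) - top K i m ∈ F K J (Multiset.card m)

lemma basis_all (b : Module.Basis (J ⊕ H) K G) {T : Submodule K G} (h : ∀ i, b i ∈ T) (x : G) :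
    x ∈ T := by
  have : (⊤ : Submodule K G) ≤ T := by
    rw [← b.span_eq, Submodule.span_le]
    rintro _ ⟨i, rfl⟩
    exact h i
  exact this trivial

lemma HasDeg.mem {b : Module.Basis (J ⊕ H) K G} {A : G →ₗ[K] S K J →ₗ[K] S K J}
    (hA : HasDeg b A) {d : ℕ} (x : G) {v : S K J} (hv : v ∈ F K J d) : A x v ∈ F K J (d+1) := by
  revert x
  intro x
  let T : Submodule K G := (F K J (d+1)).comap (A.flip v)
  refine basis_all b (T := T) (fun i => ?_) x
  show A (b i) v ∈ F K J (d+1)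
  have : F K J d ≤ (F K J (d+1)).comap (A (b i)) := by
    apply F_le
    intro m hm
    have h1 := hA i m
    have h2 : top K i m ∈ F K J (d+1) := top_mem i (by omega)
    have := Submodule.add_mem _ (F_mono (by omega : Multiset.card m ≤ d + 1) h1) h2
    simpa using this
  exact this hv

lemma sort_cases (m : Multiset J) :
    m = 0 ∨ ∃ k : J, ∃ m' : Multiset J, m = k ::ₘ m' ∧ ∀ l ∈ m', k ≤ l := by
  rcases h : m.sort with _ | ⟨k, l⟩
  · left; rw [← Multiset.sort_eq m (· ≤ ·), h]; rfl
  · right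
    refine ⟨k, l, ?_, ?_⟩
    · rw [← Multiset.sort_eq m (· ≤ ·), h]; rfl
    · have := Multiset.pairwise_sort m (· ≤ ·)
      rw [h] at this
      intro a ha
      exact (List.pairwise_cons.1 this).1 a (by simpa using ha)

variable (b : Module.Basis (J ⊕ H) K G) (Br : G →ₗ[K] G →ₗ[K] G) (χ : H → K)

lemma step_zero (A : G →ₗ[K] S K J →ₗ[K] S K J) (i : J ⊕ H) :
    step b Br χ A i 0 = top K i 0 + chi0 χ i • mono K 0 := by
  simp [step]

open Classical in
lemma step_cons (A : G →ₗ[K] S K J →ₗ[K] S K J) (i : J ⊕ H) (k : J) (m : Multiset J)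
    (h : ∀ l ∈ m, k ≤ l) :
    step b Br χ A i (k ::ₘ m) = top K i (k ::ₘ m) + if QQ k i then
        A (b (Sum.inl k)) (A (b i) (mono K m) - top K i m)
          + A (Br (b i) (b (Sum.inl k))) (mono K m)
      else 0 := by
  have hs : (k ::ₘ m).sort = k :: m.sort := Multiset.sort_cons _ _ _ h
  simp only [step, hs, Multiset.sort_eq]

lemma hasDeg_step {A : G →ₗ[K] S K J →ₗ[K] S K J} (hA : HasDeg b A) :
    HasDeg b (lin b (step b Br χ A)) := by
  intro i m
  rw [lin_apply]
  rcases sort_cases m with rfl | ⟨k, m', rfl, h⟩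
  · rw [step_zero, add_sub_cancel_left]
    exact Submodule.smul_mem _ _ (mono_mem le_rfl)
  · rw [step_cons _ _ _ _ _ _ _ h, add_sub_cancel_left, Multiset.card_cons]
    split_ifs
    · exact Submodule.add_mem _ (hA.mem _ (hA i m')) (hA.mem _ (mono_mem le_rfl))
    · exact Submodule.zero_mem _

lemma hasDeg_act (d : ℕ) : HasDeg b (act b Br χ d) := by
  induction d with
  | zero => intro i m; rw [act, lin_apply, sub_self]; exact Submodule.zero_mem _
  | succ d ih => exact hasDeg_step b Br χ ih

lemma agree {A A' : G →ₗ[K] S K J →ₗ[K] S K J} {d : ℕ}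
    (h : ∀ i (m : Multiset J), Multiset.card m ≤ d → A (b i) (mono K m) = A' (b i) (mono K m))
    (x : G) {v : S K J} (hv : v ∈ F K J d) : A x v = A' x v := by
  have key : F K J d ≤ LinearMap.eqLocus (A x) (A' x) := by
    apply F_le
    intro m hm
    show A x (mono K m) = A' x (mono K m)
    have := basis_all b (T := LinearMap.eqLocus (A.flip (mono K m)) (A'.flip (mono K m)))
      (fun i => h i m hm) x
    exact this
  exact key hv

lemma step_congr {A A' : G →ₗ[K] S K J →ₗ[K] S K J} (hA : HasDeg b A) {d : ℕ}
    (h : ∀ i (m : Multiset J), Multiset.card m < d → A (b i) (mono K m) = A' (b i) (mono K m))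
    (i) (m : Multiset J) (hm : Multiset.card m < d + 1) :
    step b Br χ A i m = step b Br χ A' i m := by
  rcases sort_cases m with rfl | ⟨k, m', rfl, hk⟩
  · rw [step_zero, step_zero]
  · rw [step_cons _ _ _ _ _ _ _ hk, step_cons _ _ _ _ _ _ _ hk]
    rw [Multiset.card_cons] at hm
    have ag := fun x (v : S K J) (hv : v ∈ F K J (Multiset.card m')) =>
      agree b (A := A) (A' := A') (fun i m hm => h i m (by omega)) x hv
    rw [ag _ _ (hA i m'), ag _ _ (mono_mem le_rfl), ag _ _ (mono_mem le_rfl)]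

lemma act_stab (d : ℕ) (i) (m : Multiset J) (hm : Multiset.card m < d) :
    act b Br χ (d+1) (b i) (mono K m) = act b Br χ d (b i) (mono K m) := by
  induction d generalizing i m with
  | zero => omega
  | succ d ih =>
    rw [act, lin_apply]
    conv_rhs => rw [act, lin_apply]
    exact step_congr b Br χ (hasDeg_act b Br χ _) (fun i m hm => ih i m hm) i m hm

lemma act_eq_Act (d : ℕ) (i) (m : Multiset J) (hm : Multiset.card m < d) :
    act b Br χ d (b i) (mono K m) = Act b Br χ (b i) (mono K m) := by
  rw [Act, lin_apply]
  induction d, (Nat.succ_le_of_lt hm) using Nat.le_induction with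
  | base => rfl
  | succ d hd ih => rw [act_stab _ _ _ _ _ _ hd, ih hd]

lemma Act_spec (i) (m : Multiset J) :
    Act b Br χ (b i) (mono K m) = step b Br χ (Act b Br χ) i m := by
  rw [← act_eq_Act b Br χ (Multiset.card m + 1) i m (Nat.lt_succ_self _), act, lin_apply]
  exact step_congr b Br χ (hasDeg_act b Br χ _) (act_eq_Act b Br χ _) i m (Nat.lt_succ_self _)

lemma Act_deg : HasDeg b (Act b Br χ) := by
  intro i m
  rw [← act_eq_Act b Br χ (Multiset.card m + 1) i m (Nat.lt_succ_self _)]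
  exact hasDeg_act b Br χ _ i m

lemma Act_R1 (j : J) (m : Multiset J) (h : ∀ l ∈ m, j ≤ l) :
    Act b Br χ (b (Sum.inl j)) (mono K m) = mono K (j ::ₘ m) := by
  rw [Act_spec]
  rcases sort_cases m with rfl | ⟨k, m', rfl, hk⟩
  · simp [step_zero, top, chi0]
  · rw [step_cons _ _ _ _ _ _ _ hk, if_neg, add_zero, top]
    have := h k (by simp)
    simpa [QQ] using this

lemma Act_R2 (h : H) : Act b Br χ (b (Sum.inr h)) (mono K 0) = χ h • mono K (0 : Multiset J) := by
  rw [Act_spec]; simp [step_zero, top, chi0]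

lemma Act_top (k : J) (i : J ⊕ H) (hi : QQ k i) (m : Multiset J) (h : ∀ l ∈ m, k ≤ l) :
    Act b Br χ (b (Sum.inl k)) (top K i m) = top K i (k ::ₘ m) := by
  cases i with
  | inl j =>
    rw [top, top, Act_R1, Multiset.cons_swap]
    intro l hl
    rcases Multiset.mem_cons.1 hl with rfl | hl
    · exact le_of_lt hi
    · exact h l hl
  | inr _ => simp [top]

lemma Act_R3 (k : J) (i : J ⊕ H) (hi : QQ k i) (m : Multiset J) (h : ∀ l ∈ m, k ≤ l) :
    Act b Br χ (b i) (mono K (k ::ₘ m)) =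
      Act b Br χ (b (Sum.inl k)) (Act b Br χ (b i) (mono K m))
       + Act b Br χ (Br (b i) (b (Sum.inl k))) (mono K m) := by
  rw [Act_spec, step_cons _ _ _ _ _ _ _ h, if_pos hi, map_sub, Act_top b Br χ k i hi m h]
  abel

/-- commutator defect -/
def Rel (A : G →ₗ[K] S K J →ₗ[K] S K J) (x y : G) (v : S K J) : Prop :=
  A x (A y v) = A y (A x v) + A (Br x y) v

lemma Rel.symm (skew : ∀ x y, Br x y = - Br y x) {A : G →ₗ[K] S K J →ₗ[K] S K J} {x y : G}
    {v : S K J} (h : Rel Br A x y v) : Rel Br A y x v := by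
  unfold Rel at *
  rw [h, skew y x]; simp

lemma Rel.add {A : G →ₗ[K] S K J →ₗ[K] S K J} {x y : G}
    {v w : S K J} (h : Rel Br A x y v) (h' : Rel Br A x y w) : Rel Br A x y (v + w) := by
  unfold Rel at *
  simp only [map_add, h, h']; abel

lemma Rel_all {A : G →ₗ[K] S K J →ₗ[K] S K J} {d : ℕ}
    (h : ∀ i j (m : Multiset J), Multiset.card m ≤ d → Rel Br A (b i) (b j) (mono K m))
    (x y : G) {v : S K J} (hv : v ∈ F K J d) : Rel Br A x y v := by
  have key : F K J d ≤ LinearMap.eqLocus (A x ∘ₗ A y) (A y ∘ₗ A x + A (Br x y)) := by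
    apply F_le
    intro m hm
    show A x (A y (mono K m)) = A y (A x (mono K m)) + A (Br x y) (mono K m)
    have := basis_all b (T := LinearMap.eqLocus (A.flip (A y (mono K m)))
      (A y ∘ₗ A.flip (mono K m) + A.flip (mono K m) ∘ₗ Br.flip y)) (fun i => ?_) x
    · exact this
    show A (b i) (A y (mono K m)) = A y (A (b i) (mono K m)) + A (Br (b i) y) (mono K m)
    have := basis_all b (T := LinearMap.eqLocus (A (b i) ∘ₗ A.flip (mono K m))
      (A.flip (A (b i) (mono K m)) + A.flip (mono K m) ∘ₗ Br (b i))) (fun j => h i j m hm) y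
    exact this
  exact key hv

lemma Act_lie (skew : ∀ x y, Br x y = - Br y x)
    (jac : ∀ x y z, Br x (Br y z) = Br (Br x y) z + Br y (Br x z))
    (self : ∀ x, Br x x = 0)
    (hH : ∀ h h' : H, Act b Br χ (Br (b (Sum.inr h)) (b (Sum.inr h'))) (mono K 0) = 0)
    (x y : G) (v : S K J) : Rel Br (Act b Br χ) x y v := by
  set A := Act b Br χ with hAdef
  have main : ∀ d : ℕ, ∀ i j (m : Multiset J), Multiset.card m ≤ d →
      Rel Br A (b i) (b j) (mono K m) := by
    intro d
    induction d using Nat.strong_induction_on with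
    | _ d IH =>
    -- case 1
    have case1 : ∀ (k : J) (i : J ⊕ H) (m : Multiset J), QQ k i → (∀ l ∈ m, k ≤ l) →
        Rel Br A (b i) (b (Sum.inl k)) (mono K m) := by
      intro k i m hi hm
      unfold Rel
      rw [hAdef, Act_R1 b Br χ k m hm, Act_R3 b Br χ k i hi m hm]
    have case2 : ∀ (k : J) (i j : J ⊕ H) (m : Multiset J), QQ k i → QQ k j → (∀ l ∈ m, k ≤ l) →
        Multiset.card m < d →
        Rel Br A (b i) (b j) (mono K (k ::ₘ m)) := by
      intro k i j m hi hj hk hm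
      have ih : ∀ x y, ∀ v ∈ F K J (Multiset.card m), Rel Br A x y v := fun x y v hv =>
        Rel_all b Br (IH _ hm) x y hv
      have hmm : mono K m ∈ F K J (Multiset.card m) := mono_mem le_rfl
      have c1 : ∀ i j : J ⊕ H, QQ k i → QQ k j →
          Rel Br A (b i) (b (Sum.inl k)) (A (b j) (mono K m)) := by
        intro i j hi hj
        have : A (b j) (mono K m) = top K j m + (A (b j) (mono K m) - top K j m) := by abel
        rw [this]
        refine Rel.add Br ?_ (ih _ _ _ (Act_deg b Br χ j m))
        cases j with
        | inr _ => simp [Rel, top]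
        | inl j =>
          apply case1 k i _ hi
          intro l hl
          rcases Multiset.mem_cons.1 hl with rfl | hl
          · exact le_of_lt hj
          · exact hk l hl
      have e1 : ∀ i j : J ⊕ H, QQ k i → QQ k j → A (b i) (A (b j) (mono K (k ::ₘ m))) =
          A (b (Sum.inl k)) (A (b i) (A (b j) (mono K m)))
          + A (Br (b i) (b (Sum.inl k))) (A (b j) (mono K m))
          + A (Br (b j) (b (Sum.inl k))) (A (b i) (mono K m))
          + A (Br (b i) (Br (b j) (b (Sum.inl k)))) (mono K m) := by
        intro i j hi hj
        have h1 := c1 i j hi hj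
        have h2 := ih (b i) (Br (b j) (b (Sum.inl k))) _ hmm
        have h3 : A (b j) (mono K (k ::ₘ m)) = _ := Act_R3 b Br χ k j hj m hk
        unfold Rel at h1 h2
        rw [h3, map_add, ← hAdef, h1, h2]
        abel
      unfold Rel
      rw [e1 i j hi hj, e1 j i hj hi]
      have h4 := ih (b i) (b j) _ hmm
      have h5 := ih (Br (b i) (b j)) (b (Sum.inl k)) _ hmm
      unfold Rel at h4 h5
      have h6 : A (b (Sum.inl k)) (mono K m) = _ := Act_R1 b Br χ k m hk
      rw [h6] at h5
      rw [h5, h4, map_add, jac (b i) (b j) (b (Sum.inl k)), map_add, LinearMap.add_apply]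
      abel
    intro i j m hm
    rcases sort_cases m with rfl | ⟨k, m', rfl, hk⟩
    · cases i with
      | inl i =>
        cases j with
        | inl j =>
          rcases lt_trichotomy i j with h | rfl | h
          · exact Rel.symm Br skew (case1 i (Sum.inl j) 0 h (by simp))
          · simp [Rel, self]
          · exact case1 j (Sum.inl i) 0 h (by simp)
        | inr j => exact Rel.symm Br skew (case1 i (Sum.inr j) 0 trivial (by simp))
      | inr i =>
        cases j with
        | inl j => exact case1 j (Sum.inr i) 0 trivial (by simp)
        | inr j =>
          unfold Rel
          rw [hAdef, hH]
          simp only [Act_R2, map_smul, add_zero]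
          rw [smul_comm]
    · rw [Multiset.card_cons] at hm
      by_cases hi : QQ k i
      · by_cases hj : QQ k j
        · exact case2 k i j m' hi hj hk (by omega)
        · cases j with
          | inr _ => exact absurd trivial hj
          | inl j =>
            have hjk : j ≤ k := not_lt.1 hj
            refine case1 j i _ ?_ ?_
            · cases i with
              | inr _ => trivial
              | inl i => exact lt_of_le_of_lt hjk hi
            · intro l hl
              rcases Multiset.mem_cons.1 hl with rfl | hl
              · exact hjk
              · exact hjk.trans (hk l hl)
      · cases i with
        | inr _ => exact absurd trivial hi
        | inl i =>
          have hik : i ≤ k := not_lt.1 hi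
          have hall : ∀ l ∈ k ::ₘ m', i ≤ l := by
              intro l hl
              rcases Multiset.mem_cons.1 hl with rfl | hl
              · exact hik
              · exact hik.trans (hk l hl)
          cases j with
          | inr j => exact Rel.symm Br skew (case1 i (Sum.inr j) _ trivial hall)
          | inl j =>
            rcases lt_trichotomy i j with h | rfl | h
            · exact Rel.symm Br skew (case1 i (Sum.inl j) _ h hall)
            · simp [Rel, self]
            · exact case1 j (Sum.inl i) _ h (fun l hl => h.le.trans (hall l hl))
  have htop : ∃ d, v ∈ F K J d := by
    refine ⟨v.support.sup Multiset.card, ?_⟩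
    rw [F, Finsupp.mem_supported]
    intro m hm
    exact Finset.le_sup (f := Multiset.card) hm
  obtain ⟨d, hd⟩ := htop
  exact Rel_all b Br (main d) x y hd

/-- universal map -/
def psi {W : Type} [AddCommGroup W] [Module K W] (ρ : G →ₗ[K] W →ₗ[K] W) (w₀ : W) :
    S K J →ₗ[K] W :=
  Finsupp.linearCombination K
    (fun m => (m.sort).foldr (fun j w => ρ (b (Sum.inl j)) w) w₀)

lemma psi_zero {W : Type} [AddCommGroup W] [Module K W] (ρ : G →ₗ[K] W →ₗ[K] W) (w₀ : W) :
    psi b ρ w₀ (mono K 0) = w₀ := by simp [psi, mono]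

lemma psi_cons {W : Type} [AddCommGroup W] [Module K W] (ρ : G →ₗ[K] W →ₗ[K] W) (w₀ : W)
    (k : J) (m : Multiset J) (h : ∀ l ∈ m, k ≤ l) :
    psi b ρ w₀ (mono K (k ::ₘ m)) = ρ (b (Sum.inl k)) (psi b ρ w₀ (mono K m)) := by
  have hs : (k ::ₘ m).sort = k :: m.sort := Multiset.sort_cons _ _ _ h
  simp [psi, mono, hs]

lemma psi_hom {W : Type} [AddCommGroup W] [Module K W] (ρ : G →ₗ[K] W →ₗ[K] W) (w₀ : W)
    (hρ : ∀ x y, ρ (Br x y) = ρ x ∘ₗ ρ y - ρ y ∘ₗ ρ x)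
    (hw : ∀ h, ρ (b (Sum.inr h)) w₀ = χ h • w₀) (x : G) (v : S K J) :
    psi b ρ w₀ (Act b Br χ x v) = ρ x (psi b ρ w₀ v) := by
  set ψ := psi b ρ w₀ with hψ
  have lift : ∀ d, (∀ i (m : Multiset J), Multiset.card m ≤ d →
      ψ (Act b Br χ (b i) (mono K m)) = ρ (b i) (ψ (mono K m))) → ∀ x, ∀ v ∈ F K J d,
      ψ (Act b Br χ x v) = ρ x (ψ v) := by
    intro d h x v hv
    have key : F K J d ≤ LinearMap.eqLocus (ψ ∘ₗ Act b Br χ x) (ρ x ∘ₗ ψ) := by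
      apply F_le
      intro m hm
      exact basis_all b (T := LinearMap.eqLocus (ψ ∘ₗ (Act b Br χ).flip (mono K m))
        (ρ.flip (ψ (mono K m)))) (fun i => h i m hm) x
    exact key hv
  have main : ∀ d, ∀ i (m : Multiset J), Multiset.card m ≤ d →
      ψ (Act b Br χ (b i) (mono K m)) = ρ (b i) (ψ (mono K m)) := by
    intro d
    induction d using Nat.strong_induction_on with
    | _ d IH =>
    have case1 : ∀ (j : J) (m : Multiset J), (∀ l ∈ m, j ≤ l) →
       ψ (Act b Br χ (b (Sum.inl j)) (mono K m)) = ρ (b (Sum.inl j)) (ψ (mono K m)) := by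
      intro j m h
      rw [Act_R1 b Br χ j m h, hψ, psi_cons b ρ w₀ j m h]
    intro i m hm
    rcases sort_cases m with rfl | ⟨k, m', rfl, hk⟩
    · cases i with
      | inl j => exact case1 j 0 (by simp)
      | inr h => rw [Act_R2, map_smul, hψ, psi_zero, hw]
    · rw [Multiset.card_cons] at hm
      by_cases hi : QQ k i
      · have ih := lift (Multiset.card m') (IH _ (by omega))
        rw [Act_R3 b Br χ k i hi m' hk, map_add, ih _ _ (mono_mem le_rfl)]
        have e : ψ (Act b Br χ (b (Sum.inl k)) (Act b Br χ (b i) (mono K m')))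
            = ρ (b (Sum.inl k)) (ψ (Act b Br χ (b i) (mono K m'))) := by
          have : Act b Br χ (b i) (mono K m') =
            top K i m' + (Act b Br χ (b i) (mono K m') - top K i m') := by abel
          rw [this, map_add, map_add, ih _ _ (Act_deg b Br χ i m'), map_add, map_add]
          congr 1
          cases i with
          | inr _ => simp [top]
          | inl j =>
            apply case1
            intro l hl
            rcases Multiset.mem_cons.1 hl with rfl | hl
            · exact le_of_lt hi
            · exact hk l hl
        rw [e, ih _ _ (mono_mem le_rfl), hψ, psi_cons b ρ w₀ k m' hk, hρ]
        simp
      · cases i with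
        | inr _ => exact absurd trivial hi
        | inl i =>
          have hik : i ≤ k := not_lt.1 hi
          apply case1
          intro l hl
          rcases Multiset.mem_cons.1 hl with rfl | hl
          · exact hik
          · exact hik.trans (hk l hl)
  refine lift (v.support.sup Multiset.card) (main _) x v ?_
  rw [F, Finsupp.mem_supported]
  intro m hm
  exact Finset.le_sup (f := Multiset.card) hm

lemma gen (T : Submodule K (S K J)) (h0 : mono K 0 ∈ T)
    (hT : ∀ x, ∀ v ∈ T, Act b Br χ x v ∈ T) : T = ⊤ := by
  have main : ∀ d : ℕ, ∀ m : Multiset J, Multiset.card m = d → mono K m ∈ T := by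
    intro d
    induction d with
    | zero => intro m hm; rw [Multiset.card_eq_zero.1 hm]; exact h0
    | succ d ih =>
      intro m hm
      rcases sort_cases m with rfl | ⟨k, m', rfl, hk⟩
      · exact h0
      · rw [← Act_R1 b Br χ k m' hk]
        exact hT _ _ (ih m' (by simpa using hm))
  rw [eq_top_iff, ← Finsupp.supported_univ, Finsupp.supported_eq_span_single, Submodule.span_le]
  rintro _ ⟨m, -, rfl⟩
  exact main _ m rfl

end
end PBW

namespace VacMod

open HahnSeries in
lemma deriv_coeff (f : LaurentSeries ℂ) (n : ℤ) :
    (LSderiv f).coeff n = ((n : ℂ) + 1) * f.coeff (n + 1) := by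
  have := LaurentSeries.hasseDeriv_coeff (R := ℂ) 1 f n
  rw [LSderiv, LaurentSeries.derivative_apply, this]
  simp

/-- Euler operator. -/
def theta (f : LaurentSeries ℂ) : LaurentSeries ℂ :=
  ⟨fun n => (n : ℂ) * f.coeff n, f.isPWO_support.mono (fun n hn => by
    intro h; apply hn; simp only; rw [h, mul_zero])⟩

lemma theta_mul (f h : LaurentSeries ℂ) : theta (f * h) = theta f * h + f * theta h := by
  ext n
  have s1 : (theta f).support ⊆ f.support := fun n hn h0 => hn (by simp [theta, h0])
  have s2 : (theta h).support ⊆ h.support := fun n hn h0 => hn (by simp [theta, h0])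
  rw [HahnSeries.coeff_add, HahnSeries.coeff_mul_left' f.isPWO_support s1,
    HahnSeries.coeff_mul_right' h.isPWO_support s2]
  simp only [theta]
  rw [HahnSeries.coeff_mul, Finset.mul_sum, ← Finset.sum_add_distrib]
  apply Finset.sum_congr rfl
  rintro ⟨i, j⟩ hij
  have : i + j = n := by simpa using (Finset.mem_antidiagonal.1 hij).2.2
  subst this
  push_cast
  ring

lemma deriv_eq (f : LaurentSeries ℂ) :
    LSderiv f = HahnSeries.single (-1 : ℤ) (1 : ℂ) * theta f := by
  ext n
  rw [deriv_coeff]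
  have := HahnSeries.coeff_single_mul_add (r := (1:ℂ)) (x := theta f) (a := n + 1) (b := (-1 : ℤ))
  rw [show n + 1 + -1 = n by ring] at this
  rw [this]
  simp [theta]

lemma deriv_mul (f h : LaurentSeries ℂ) : LSderiv (f * h) = LSderiv f * h + f * LSderiv h := by
  simp only [deriv_eq, theta_mul]; ring

lemma deriv_add (f h : LaurentSeries ℂ) : LSderiv (f + h) = LSderiv f + LSderiv h :=
  map_add _ _ _

lemma deriv_C (c : ℂ) : LSderiv (HahnSeries.C c) = 0 := by
  ext n
  rw [deriv_coeff]
  by_cases h : n + 1 = 0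
  · have : (n : ℂ) + 1 = 0 := by exact_mod_cast h
    simp [this]
  · rw [HahnSeries.C_apply, HahnSeries.coeff_single_of_ne h]; simp

lemma algMap_eq (c : ℂ) : algebraMap ℂ (LaurentSeries ℂ) c = HahnSeries.C c := by
  exact LaurentSeries.algebraMap_apply ℂ c

lemma polyToL_deriv (Q : Polynomial ℂ) :
    LSderiv (polyToL Q) = polyToL (Polynomial.derivative Q) := by
  induction Q using Polynomial.induction_on' with
  | add p q hp hq => 
    have e : ∀ p q, polyToL (p + q) = polyToL p + polyToL q := fun p q => map_add _ _ _
    rw [e, deriv_add, hp, hq, map_add, e]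
  | monomial n a =>
    simp only [polyToL, Polynomial.derivative_monomial, Polynomial.aeval_monomial, algMap_eq]
    rw [deriv_mul, deriv_C, zero_mul, zero_add]
    have hz : LSderiv (HahnSeries.single (1:ℤ) (1:ℂ)) = 1 := by
      have := LaurentSeries.hasseDeriv_single (R := ℂ) 1 1 (1 : ℂ)
      rw [LSderiv, LaurentSeries.derivative_apply, this]
      simp
    have hp : ∀ n : ℕ, LSderiv ((HahnSeries.single (1:ℤ) (1:ℂ)) ^ n)
        = HahnSeries.C (n : ℂ) * (HahnSeries.single (1:ℤ) (1:ℂ)) ^ (n - 1) := by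
      intro n
      induction n with
      | zero => 
        have := deriv_C 1
        simpa using this
      | succ n ih =>
        rw [pow_succ, deriv_mul, ih, hz]
        cases n with
        | zero => simp
        | succ k => 
          simp only [Nat.add_sub_cancel, Nat.cast_add, Nat.cast_one, map_add, map_one]
          ring
    rw [hp, map_mul]
    ring

lemma hasse_deriv (P : Polynomial ℂ) (j : ℕ) :
    LSderiv (polyToL (Polynomial.hasseDeriv j P)) =
      HahnSeries.C ((j : ℂ) + 1) * polyToL (Polynomial.hasseDeriv (j + 1) P) := by
  rw [polyToL_deriv, ← Polynomial.hasseDeriv_one]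
  have := LinearMap.congr_fun (Polynomial.hasseDeriv_comp (R := ℂ) 1 j) P
  rw [LinearMap.comp_apply] at this
  rw [this]
  simp only [LinearMap.smul_apply, Nat.choose_one_right, add_comm 1 j]
  have e : HahnSeries.C ((j : ℂ) + 1) = (((j + 1 : ℕ)) : LaurentSeries ℂ) := by
    rw [← map_natCast (HahnSeries.C (Γ := ℤ) (R := ℂ)) (j + 1)]
    push_cast; rfl
  rw [e, polyToL, map_nsmul, nsmul_eq_mul]; rfl

lemma hDiv_deriv (P : Polynomial ℂ) (i : ℤ) :
    LSderiv (hDiv P i) = HahnSeries.C ((i : ℂ) + 1) * hDiv P (i + 1) := by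
  unfold hDiv
  rcases lt_trichotomy i (-1) with h | rfl | h
  · rw [if_neg (by omega), if_neg (by omega)]; simp
  · simp
  · lift i to ℕ using (by omega)
    rw [if_pos (by omega), if_pos (by omega)]
    have : ((i : ℤ) + 1).toNat = i + 1 := by omega
    rw [this]
    simpa using hasse_deriv P i

lemma hDiv_sum (P : Polynomial ℂ) (s : ℤ) :
    (∑ j ∈ Finset.range (P.natDegree + 1),
      if s + (j : ℤ) = 0 then polyToL (Polynomial.hasseDeriv j P) else 0) = hDiv P (-s) := by
  unfold hDiv
  split_ifs with h
  · by_cases hd : (-s).toNat < P.natDegree + 1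
    · rw [Finset.sum_eq_single_of_mem (-s).toNat (Finset.mem_range.2 hd)]
      · rw [if_pos (by omega)]
      · intro j _ hj
        rw [if_neg (by omega)]
    · rw [Polynomial.hasseDeriv_eq_zero_of_lt_natDegree P _ (by omega)]
      rw [Finset.sum_eq_zero]
      · simp [polyToL]
      · intro j hj
        rw [if_neg]
        have := Finset.mem_range.1 hj
        omega
  · apply Finset.sum_eq_zero
    intro j hj
    rw [if_neg (by omega)]

end VacMod

set_option linter.unusedSectionVars false
set_option linter.unusedSimpArgs false
namespace VacMod

structure Setup (g : Type) [LieRing g] [LieAlgebra ℂ g] (K : Type) [CommRing K]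
    (X : Type) [AddCommGroup X] [Module K X] where
  cc : ℂ →+* K
  dL : K →+ K
  dL_mul : ∀ f h, dL (f * h) = dL f * h + f * dL h
  dL_cc : ∀ c, dL (cc c) = 0
  N : ℕ
  q : ℕ → K
  q_top : q (N + 1) = 0
  q_deriv : ∀ j : ℕ, dL (q j) = cc ((j : ℂ) + 1) * q (j + 1)
  hD : ℤ → K
  hD_deriv : ∀ i : ℤ, dL (hD i) = cc ((i : ℂ) + 1) * hD (i + 1)
  hD_neg : ∀ i : ℤ, i < 0 → hD i = 0
  hD_sum : ∀ t : ℤ, (∑ j ∈ Finset.range (N + 1), if t + (j : ℤ) = 0 then q j else 0) = hD (-t)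
  Φ : g →ₗ[ℂ] g →ₗ[ℂ] ℂ
  hsymm : ∀ a b : g, Φ a b = Φ b a
  hinv : ∀ a b c : g, Φ ⁅a, b⁆ c = Φ a ⁅b, c⁆
  eA : g → ℤ → X
  eB : g → ℤ → X
  eK : X
  eA_add : ∀ a b n, eA (a + b) n = eA a n + eA b n
  eB_add : ∀ a b n, eB (a + b) n = eB a n + eB b n
  ind : ∀ T : Submodule K X, (∀ a n, eA a n ∈ T) → (∀ a n, eB a n ∈ T) → eK ∈ T → ∀ x, x ∈ T
  B : X →ₗ[K] X →ₗ[K] X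
  hkl : ∀ x, B eK x = 0
  hkr : ∀ x, B x eK = 0
  haa : ∀ (a b : g) (m n : ℤ), B (eA a m) (eA b n) = eA ⁅a, b⁆ (m + n) +
    (if m + n = 0 then cc (m * Φ a b) else 0) • eK
  hab : ∀ (a b : g) (m n : ℤ), B (eA a m) (eB b n) = eB ⁅a, b⁆ (m + n)
  hba : ∀ (a b : g) (m n : ℤ), B (eB a m) (eA b n) = eB ⁅a, b⁆ (m + n)
  hbb : ∀ (a b : g) (m n : ℤ), B (eB a m) (eB b n) =
    (∑ j ∈ Finset.range (N + 1), q j • eA ⁅a, b⁆ (m + n + (j : ℤ)))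
      + (cc ((1 / 2 : ℂ) * ((m : ℂ) - (n : ℂ)) * Φ a b) * hD (-m - n)) • eK
  d : X →+ X
  d_smul : ∀ (f : K) (x : X), d (f • x) = dL f • x + f • d x
  d_A : ∀ a n, d (eA a n) = - (cc n • eA a (n - 1))
  d_B : ∀ a n, d (eB a n) = - (cc n • eB a (n - 1))
  d_K : d eK = 0

namespace Setup

variable {K X : Type} [CommRing K] [AddCommGroup X] [Module K X] (s : Setup g K X)

def AA (n : ℤ) : g →+ X := ⟨⟨fun a => s.eA a n, by
  have := s.eA_add 0 0 n; rw [add_zero] at this; simpa using this⟩, fun a b => s.eA_add a b n⟩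
def BB (n : ℤ) : g →+ X := ⟨⟨fun a => s.eB a n, by
  have := s.eB_add 0 0 n; rw [add_zero] at this; simpa using this⟩, fun a b => s.eB_add a b n⟩

def SA (n : ℤ) : g →+ X := ∑ j ∈ Finset.range (s.N + 1),
  (DistribSMul.toAddMonoidHom X (s.q j)).comp (s.AA (n + j))
def SB (n : ℤ) : g →+ X := ∑ j ∈ Finset.range (s.N + 1),
  (DistribSMul.toAddMonoidHom X (s.q j)).comp (s.BB (n + j))

lemma SA_apply (n : ℤ) (a : g) : s.SA n a = ∑ j ∈ Finset.range (s.N + 1),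
  s.q j • s.AA (n + j) a := by
  simp [SA, AddMonoidHom.finsetSum_apply]
lemma SB_apply (n : ℤ) (a : g) : s.SB n a = ∑ j ∈ Finset.range (s.N + 1),
  s.q j • s.BB (n + j) a := by
  simp [SB, AddMonoidHom.finsetSum_apply]

lemma iaa (a b : g) (m n : ℤ) : s.B (s.AA m a) (s.AA n b) = s.AA (m + n) ⁅a, b⁆ +
    (if m + n = 0 then s.cc (m * s.Φ a b) else 0) • s.eK := s.haa a b m n
lemma iab (a b : g) (m n : ℤ) : s.B (s.AA m a) (s.BB n b) = s.BB (m + n) ⁅a, b⁆ := s.hab a b m n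
lemma iba (a b : g) (m n : ℤ) : s.B (s.BB m a) (s.AA n b) = s.BB (m + n) ⁅a, b⁆ := s.hba a b m n
lemma ibb (a b : g) (m n : ℤ) : s.B (s.BB m a) (s.BB n b) = s.SA (m + n) ⁅a, b⁆
      + (s.cc ((1 / 2 : ℂ) * ((m : ℂ) - (n : ℂ)) * s.Φ a b) * s.hD (-m - n)) • s.eK := by
  rw [SA_apply]; exact s.hbb a b m n
lemma dA (a : g) (n : ℤ) : s.d (s.AA n a) = - (s.cc n • s.AA (n - 1) a) := s.d_A a n
lemma dB (a : g) (n : ℤ) : s.d (s.BB n a) = - (s.cc n • s.BB (n - 1) a) := s.d_B a n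

lemma iaSA (a b : g) (m n : ℤ) : s.B (s.AA m a) (s.SA n b) = s.SA (m + n) ⁅a, b⁆ +
    (s.cc (m * s.Φ a b) * s.hD (-(m + n))) • s.eK := by
  rw [← s.hD_sum, Finset.mul_sum, Finset.sum_smul, SA_apply, SA_apply, map_sum,
    ← Finset.sum_add_distrib]
  refine Finset.sum_congr rfl fun j _ => ?_
  rw [map_smul, iaa, smul_add, add_assoc, smul_smul]
  congr 2
  split_ifs <;> ring

lemma ibSA (a b : g) (m n : ℤ) : s.B (s.BB m a) (s.SA n b) = s.SB (m + n) ⁅a, b⁆ := by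
  rw [SA_apply, SB_apply, map_sum]
  refine Finset.sum_congr rfl fun j _ => ?_
  rw [map_smul, iba, add_assoc]

lemma dSA (a : g) (n : ℤ) : s.d (s.SA n a) = - (s.cc n • s.SA (n - 1) a) := by
  rw [SA_apply, SA_apply, map_sum]
  have e : ∀ j : ℕ, s.d (s.q j • s.AA (n + j) a)
    = (s.cc ((j + 1 : ℕ) : ℂ) * s.q (j + 1)) •
        s.AA (n - 1 + (j + 1 : ℕ)) a
      - (s.cc (j : ℂ) * s.q j) • s.AA (n - 1 + j) a
      - s.cc n • (s.q j • s.AA (n - 1 + j) a) := by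
    intro j
    rw [d_smul, q_deriv, dA]
    have e1 : n - 1 + ((j + 1 : ℕ) : ℤ) = n + j := by push_cast; ring
    have e2 : n + (j : ℤ) - 1 = n - 1 + j := by ring
    rw [e1, e2]
    have e3 : s.cc (((n + j : ℤ)) : ℂ) = s.cc n + s.cc j := by rw [← map_add]; push_cast; rfl
    have e4 : s.cc (((j + 1 : ℕ)) : ℂ) = s.cc ((j : ℂ) + 1) := by push_cast; rfl
    rw [e3, e4]
    module
  simp only [e]
  rw [Finset.sum_sub_distrib, Finset.sum_range_sub (fun j : ℕ => (s.cc (j : ℂ) *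
    s.q j) • s.AA (n - 1 + j) a), ← Finset.smul_sum,
    s.q_top]
  simp

lemma ext3 {T : X → Prop} (h0 : T 0) (add : ∀ x y, T x → T y → T (x + y))
    (smul : ∀ (f : K) x, T x → T (f • x))
    (hA : ∀ n a, T (s.AA n a)) (hB : ∀ n a, T (s.BB n a)) (hK : T s.eK) (x : X) : T x :=
  s.ind ⟨⟨⟨{x | T x}, fun {x y} => add x y⟩, h0⟩, fun f x => smul f x⟩
    (fun a n => hA n a) (fun a n => hB n a) hK x

lemma skew (x y : X) : s.B x y = - s.B y x := by
  induction x using s.ext3 with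
  | h0 => simp
  | add u v hu hv => simp only [map_add, LinearMap.add_apply, hu, hv]; abel
  | smul f u hu => simp only [map_smul, LinearMap.smul_apply, hu, smul_neg]
  | hK => rw [s.hkl, s.hkr, neg_zero]
  | hA m a =>
    induction y using s.ext3 with
    | h0 => simp
    | add u v hu hv => simp only [map_add, LinearMap.add_apply, hu, hv]; abel
    | smul f u hu => simp only [map_smul, LinearMap.smul_apply, hu, smul_neg]
    | hK => rw [s.hkl, s.hkr, neg_zero]
    | hA n b =>
      rw [iaa, iaa, ← lie_skew b a, map_neg, add_comm n m, s.hsymm b a]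
      split_ifs with h
      · have : n = -m := by omega
        subst this
        have : s.cc ((-m : ℤ) * s.Φ a b) = - s.cc (m * s.Φ a b) := by rw [← map_neg]; push_cast; ring_nf
        rw [this]; module
      · module
    | hB n b => rw [iab, iba, ← lie_skew b a, map_neg, add_comm n m, neg_neg]
  | hB m a =>
    induction y using s.ext3 with
    | h0 => simp
    | add u v hu hv => simp only [map_add, LinearMap.add_apply, hu, hv]; abel
    | smul f u hu => simp only [map_smul, LinearMap.smul_apply, hu, smul_neg]
    | hK => rw [s.hkl, s.hkr, neg_zero]
    | hA n b => rw [iab, iba, ← lie_skew b a, map_neg, add_comm n m, neg_neg]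
    | hB n b =>
      rw [ibb, ibb, ← lie_skew b a, map_neg, add_comm n m, s.hsymm b a,
        show -n - m = -m - n by ring]
      have : s.cc (1 / 2 * ((n : ℂ) - m) * s.Φ a b) = - s.cc (1 / 2 * ((m : ℂ) - n) * s.Φ a b) := by
        rw [← map_neg]; ring_nf
      rw [this]; module

lemma self (x : X) : s.B x x = 0 := by
  have := s.skew x x
  have h2 : (2 : K) • s.B x x = 0 := by
    rw [two_smul]; nth_rewrite 1 [this]; simp
  have h3 : s.cc (1 / 2) * 2 = 1 := by
    rw [← map_ofNat s.cc 2, ← map_mul]; norm_num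
  rw [← one_smul K (s.B x x), ← h3, mul_smul, h2, smul_zero]

def Jac (x y z : X) : Prop := s.B x (s.B y z) + s.B y (s.B z x) + s.B z (s.B x y) = 0

lemma Jac.cyc {x y z : X} (h : s.Jac x y z) : s.Jac y z x := by
  unfold Jac at *; rw [← h]; abel

lemma lj (a b c : g) : ⁅a, ⁅b, c⁆⁆ = - ⁅b, ⁅c, a⁆⁆ - ⁅c, ⁅a, b⁆⁆ := by
  have := lie_jacobi a b c
  rw [sub_eq_add_neg, ← neg_add, ← add_eq_zero_iff_eq_neg, ← add_assoc]; exact this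

lemma cy1 (a b c : g) : s.Φ b ⁅c, a⁆ = s.Φ a ⁅b, c⁆ := by
  rw [← s.hinv, s.hsymm]
lemma cy2 (a b c : g) : s.Φ c ⁅a, b⁆ = s.Φ a ⁅b, c⁆ := by
  rw [s.hsymm, s.hinv]

lemma jAAA (a b c : g) (m n r : ℤ) : s.Jac (s.AA m a) (s.AA n b) (s.AA r c) := by
  unfold Jac
  simp only [iaa, map_add, map_smul, s.hkr, smul_zero, add_zero, s.cy1 a b c, s.cy2 a b c]
  rw [lj a b c, map_sub, map_neg, show n + (r + m) = m + (n + r) by ring,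
    show r + (m + n) = m + (n + r) by ring]
  split_ifs with h
  · have h' : r = - m - n := by omega
    subst h'
    have : s.cc (((-m - n : ℤ) : ℂ) * s.Φ a ⁅b, c⁆) = - s.cc (m * s.Φ a ⁅b, c⁆) - s.cc (n * s.Φ a ⁅b, c⁆) := by
      rw [← map_neg, ← map_sub]; push_cast; ring_nf
    rw [this]
    module
  · module

lemma jAAB (a b c : g) (m n r : ℤ) : s.Jac (s.AA m a) (s.AA n b) (s.BB r c) := by
  unfold Jac
  simp only [iaa, iab, iba, map_add, map_smul, s.hkr, smul_zero, add_zero]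
  rw [lj a b c, map_sub, map_neg, show n + (r + m) = m + (n + r) by ring,
    show r + (m + n) = m + (n + r) by ring]
  module

lemma jABB (a b c : g) (m n r : ℤ) : s.Jac (s.AA m a) (s.BB n b) (s.BB r c) := by
  unfold Jac
  simp only [iaa, iab, iba, ibb, iaSA, map_add, map_smul, s.hkr, smul_zero, add_zero,
    s.cy1 a b c, s.cy2 a b c]
  rw [lj a b c, map_sub, map_neg, show n + (r + m) = m + (n + r) by ring,
    show r + (m + n) = m + (n + r) by ring, show -n - (r + m) = -(m + (n + r)) by ring,
    show -r - (m + n) = -(m + (n + r)) by ring]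
  have e : s.cc (1 / 2 * ((n : ℂ) - ((r + m : ℤ) : ℂ)) * s.Φ a ⁅b, c⁆) =
    - s.cc (m * s.Φ a ⁅b, c⁆) - s.cc (1 / 2 * ((r : ℂ) - ((m + n : ℤ) : ℂ)) * s.Φ a ⁅b, c⁆) := by
    rw [← map_neg, ← map_sub]; push_cast; ring_nf
  rw [e]
  module

lemma jBBB (a b c : g) (m n r : ℤ) : s.Jac (s.BB m a) (s.BB n b) (s.BB r c) := by
  unfold Jac
  simp only [ibb, ibSA, map_add, map_smul, s.hkr, smul_zero, add_zero]
  rw [lj a b c, map_sub, map_neg, show n + (r + m) = m + (n + r) by ring,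
    show r + (m + n) = m + (n + r) by ring]
  module

lemma Jac_ext {y z : X} (hA : ∀ n a, s.Jac (s.AA n a) y z) (hB : ∀ n a, s.Jac (s.BB n a) y z)
    (x : X) : s.Jac x y z := by
  induction x using s.ext3 with
  | h0 => simp [Jac]
  | add u v hu hv =>
    unfold Jac at *
    simp only [map_add, LinearMap.add_apply]
    rw [← add_zero (0 : X)]
    nth_rewrite 1 [← hu]
    nth_rewrite 1 [← hv]
    abel
  | smul f u hu =>
    unfold Jac at *
    simp only [map_smul, LinearMap.smul_apply, ← smul_add, hu, smul_zero]
  | hA n a => exact hA n a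
  | hB n a => exact hB n a
  | hK => simp [Jac, s.hkl, s.hkr]

lemma jac (x y z : X) : s.Jac x y z := by
  apply s.Jac_ext
  · intro m a
    refine Jac.cyc s (Jac.cyc s (?_))
    apply s.Jac_ext
    · intro n b
      refine Jac.cyc s (Jac.cyc s (?_))
      apply s.Jac_ext
      · intro r c; exact s.jAAA _ _ _ _ _ _
      · intro r c; exact Jac.cyc s (Jac.cyc s (s.jAAB _ _ _ _ _ _))
    · intro n b
      refine Jac.cyc s (Jac.cyc s (?_))
      apply s.Jac_ext
      · intro r c; exact s.jAAB _ _ _ _ _ _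
      · intro r c; exact Jac.cyc s (Jac.cyc s (s.jABB _ _ _ _ _ _))
  · intro m a
    refine Jac.cyc s (Jac.cyc s (?_))
    apply s.Jac_ext
    · intro n b
      refine Jac.cyc s (Jac.cyc s (?_))
      apply s.Jac_ext
      · intro r c; exact Jac.cyc s (s.jAAB _ _ _ _ _ _)
      · intro r c; exact Jac.cyc s (s.jABB _ _ _ _ _ _)
    · intro n b
      refine Jac.cyc s (Jac.cyc s (?_))
      apply s.Jac_ext
      · intro r c; exact s.jABB _ _ _ _ _ _
      · intro r c; exact s.jBBB _ _ _ _ _ _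

lemma leib (x y z : X) : s.B x (s.B y z) = s.B (s.B x y) z + s.B y (s.B x z) := by
  have h := s.jac x y z
  unfold Jac at h
  rw [s.skew (s.B x y) z, s.skew x z, map_neg]
  rw [← sub_eq_zero, ← h]; abel

/-- `d` is a derivation. -/
lemma d_der (x y : X) : s.d (s.B x y) = s.B (s.d x) y + s.B x (s.d y) := by
  have hdK : ∀ f : K, s.d (f • s.eK) = s.dL f • s.eK := by
    intro f; rw [d_smul, d_K, smul_zero, add_zero]
  induction x using s.ext3 with
  | h0 => simp
  | add u v hu hv => simp only [map_add, LinearMap.add_apply, hu, hv]; abel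
  | smul f u hu =>
    simp only [map_smul, LinearMap.smul_apply, d_smul, hu, map_add, LinearMap.add_apply]; module
  | hK => simp [s.hkl, s.d_K]
  | hA m a =>
    induction y using s.ext3 with
    | h0 => simp
    | add u v hu hv => simp only [map_add, LinearMap.add_apply, hu, hv]; abel
    | smul f u hu =>
      simp only [map_smul, LinearMap.smul_apply, d_smul, hu, map_add, LinearMap.add_apply]; module
    | hK => simp [s.hkr, s.d_K]
    | hA n b =>
      simp only [iaa, dA, map_add, hdK, map_neg, map_smul, LinearMap.neg_apply, LinearMap.smul_apply]
      rw [show m - 1 + n = m + n - 1 by ring, show m + (n - 1) = m + n - 1 by ring]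
      have e : s.cc ((m + n : ℤ) : ℂ) = s.cc m + s.cc n := by rw [← map_add]; push_cast; rfl
      have e0 : s.dL (if m + n = 0 then s.cc (m * s.Φ a b) else 0) = 0 := by
        split_ifs
        · exact s.dL_cc _
        · exact map_zero _
      rw [e, e0]
      split_ifs with h
      · have : n = 1 - m := by omega
        subst this
        have e2 : s.cc m * s.cc ((m - 1 : ℤ) * s.Φ a b) + s.cc ((1 - m : ℤ) : ℂ) * s.cc (m * s.Φ a b) = 0 := by
          rw [← map_mul, ← map_mul, ← map_add]; push_cast; ring_nf; simp
        have e3 : (s.cc m * s.cc ((m - 1 : ℤ) * s.Φ a b) + s.cc ((1 - m : ℤ) : ℂ) * s.cc (m * s.Φ a b)) • s.eK = 0 := by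
          rw [e2, zero_smul]
        rw [← sub_eq_zero, ← e3]
        module
      · module
    | hB n b =>
      simp only [iab, dA, dB, map_neg, map_smul, LinearMap.neg_apply, LinearMap.smul_apply]
      rw [show m - 1 + n = m + n - 1 by ring, show m + (n - 1) = m + n - 1 by ring]
      have e : s.cc ((m + n : ℤ) : ℂ) = s.cc m + s.cc n := by rw [← map_add]; push_cast; rfl
      rw [e]; module
  | hB m a =>
    induction y using s.ext3 with
    | h0 => simp
    | add u v hu hv => simp only [map_add, LinearMap.add_apply, hu, hv]; abel
    | smul f u hu =>
      simp only [map_smul, LinearMap.smul_apply, d_smul, hu, map_add, LinearMap.add_apply]; module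
    | hK => simp [s.hkr, s.d_K]
    | hA n b =>
      simp only [iba, dA, dB, map_neg, map_smul, LinearMap.neg_apply, LinearMap.smul_apply]
      rw [show m - 1 + n = m + n - 1 by ring, show m + (n - 1) = m + n - 1 by ring]
      have e : s.cc ((m + n : ℤ) : ℂ) = s.cc m + s.cc n := by rw [← map_add]; push_cast; rfl
      rw [e]; module
    | hB n b =>
      simp only [ibb, dB, map_add, hdK, dSA, map_neg, map_smul, LinearMap.neg_apply,
        LinearMap.smul_apply]
      rw [show m - 1 + n = m + n - 1 by ring, show m + (n - 1) = m + n - 1 by ring]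
      have e : s.cc ((m + n : ℤ) : ℂ) = s.cc m + s.cc n := by rw [← map_add]; push_cast; rfl
      rw [e, s.dL_mul, s.dL_cc, zero_mul, zero_add, s.hD_deriv,
        show -(m - 1) - n = -m - n + 1 by ring, show -m - (n - 1) = -m - n + 1 by ring]
      have e2 : s.cc (1 / 2 * ((m : ℂ) - n) * s.Φ a b) * s.cc (((-m - n : ℤ) : ℂ) + 1)
        = - (s.cc m * s.cc (1 / 2 * (((m - 1 : ℤ) : ℂ) - n) * s.Φ a b))
          - s.cc n * s.cc (1 / 2 * ((m : ℂ) - ((n - 1 : ℤ) : ℂ)) * s.Φ a b) := by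
        simp only [← map_mul, ← map_neg, ← map_sub]; push_cast; ring_nf
      rw [← mul_assoc, e2]
      module

end Setup
end VacMod

set_option linter.unusedSectionVars false
set_option linter.unusedSimpArgs false
namespace VacMod
namespace Setup

variable {K X : Type} [CommRing K] [AddCommGroup X] [Module K X] (s : Setup g K X)

/-- generators of the subalgebra `B̌`. -/
def Gn : Set X := {x | (∃ a n, 0 ≤ n ∧ x = s.AA n a) ∨ (∃ a n, 0 ≤ n ∧ x = s.BB n a) ∨ x = s.eK}

structure Pol {J H : Type} (b : Module.Basis (J ⊕ H) K X) (ℓ : ℂ) where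
  χ : X →ₗ[K] K
  hχA : ∀ a n, χ (s.AA n a) = 0
  hχB : ∀ a n, χ (s.BB n a) = 0
  hχK : χ s.eK = s.cc ℓ
  h1 : s.Gn ⊆ (Submodule.span K (Set.range fun h => b (Sum.inr h)) : Submodule K X)
  h2 : ∀ h, b (Sum.inr h) ∈ Submodule.span K s.Gn

namespace Pol

variable {J H : Type} [LinearOrder J] {b : Module.Basis (J ⊕ H) K X} {ℓ : ℂ} {s}
  (p : s.Pol b ℓ)

abbrev V (_p : s.Pol b ℓ) : Type := PBW.S K J

def ac : X →ₗ[K] p.V →ₗ[K] p.V := PBW.Act b s.B (fun h => p.χ (b (Sum.inr h)))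

def vac : p.V := PBW.mono K 0

lemma ac_span {x : X} (hx : x ∈ Submodule.span K s.Gn) : p.ac x p.vac = p.χ x • p.vac := by
  have key : Submodule.span K s.Gn ≤ LinearMap.eqLocus (p.ac.flip p.vac)
      (LinearMap.toSpanSingleton K _ p.vac ∘ₗ p.χ) := by
    refine (Submodule.span_le.2 p.h1).trans (Submodule.span_le.2 ?_)
    rintro _ ⟨h, rfl⟩
    exact PBW.Act_R2 b s.B (fun h => p.χ (b (Sum.inr h))) h
  simpa using key hx

lemma genA (a : g) {n : ℤ} (hn : 0 ≤ n) : s.AA n a ∈ Submodule.span K s.Gn :=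
  Submodule.subset_span (Or.inl ⟨a, n, hn, rfl⟩)
lemma genB (a : g) {n : ℤ} (hn : 0 ≤ n) : s.BB n a ∈ Submodule.span K s.Gn :=
  Submodule.subset_span (Or.inr (Or.inl ⟨a, n, hn, rfl⟩))
lemma genK : s.eK ∈ Submodule.span K s.Gn :=
  Submodule.subset_span (Or.inr (Or.inr rfl))

lemma SA_mem (a : g) {n : ℤ} (hn : 0 ≤ n) : s.SA n a ∈ Submodule.span K s.Gn := by
  rw [SA_apply]
  exact Submodule.sum_mem _ fun j _ => Submodule.smul_mem _ _ (genA a (by omega))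

lemma χSA (a : g) (n : ℤ) : p.χ (s.SA n a) = 0 := by
  rw [SA_apply, map_sum]
  exact Finset.sum_eq_zero fun j _ => by rw [map_smul, p.hχA, smul_zero]

def Tz : Submodule K X := Submodule.span K s.Gn ⊓ LinearMap.ker p.χ

lemma br_gen {x y : X} (hx : x ∈ s.Gn) (hy : y ∈ s.Gn) : s.B x y ∈ p.Tz := by
  rcases hx with ⟨a, m, hm, rfl⟩ | ⟨a, m, hm, rfl⟩ | rfl
  · rcases hy with ⟨c, n, hn, rfl⟩ | ⟨c, n, hn, rfl⟩ | rfl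
    · have e : (if m + n = 0 then s.cc (m * s.Φ a c) else 0) = 0 := by
        split_ifs with h
        · have : m = 0 := by omega
          simp [this]
        · rfl
      rw [iaa, e, zero_smul, add_zero]
      exact ⟨genA _ (by omega), p.hχA _ _⟩
    · rw [iab]; exact ⟨genB _ (by omega), p.hχB _ _⟩
    · rw [s.hkr]; exact Submodule.zero_mem _
  · rcases hy with ⟨c, n, hn, rfl⟩ | ⟨c, n, hn, rfl⟩ | rfl
    · rw [iba]; exact ⟨genB _ (by omega), p.hχB _ _⟩
    · have e : s.cc (1 / 2 * ((m : ℂ) - n) * s.Φ a c) * s.hD (-m - n) = 0 := by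
        by_cases h : -m - n < 0
        · rw [s.hD_neg _ h, mul_zero]
        · have h1 : m = 0 := by omega
          have h2 : n = 0 := by omega
          simp [h1, h2]
      rw [ibb, e, zero_smul, add_zero]
      exact ⟨SA_mem _ (by omega), p.χSA _ _⟩
    · rw [s.hkr]; exact Submodule.zero_mem _
  · rw [s.hkl]; exact Submodule.zero_mem _

lemma br_span {x y : X} (hx : x ∈ Submodule.span K s.Gn) (hy : y ∈ Submodule.span K s.Gn) :
    s.B x y ∈ p.Tz := by
  have k1 : ∀ x ∈ s.Gn, Submodule.span K s.Gn ≤ p.Tz.comap (s.B x) := by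
    intro x hx
    exact Submodule.span_le.2 fun y hy => p.br_gen hx hy
  have k2 : Submodule.span K s.Gn ≤ p.Tz.comap (s.B.flip y) :=
    Submodule.span_le.2 fun x hx => k1 x hx hy
  exact k2 hx

lemma lie (x y : X) (v : p.V) : p.ac x (p.ac y v) = p.ac y (p.ac x v) + p.ac (s.B x y) v := by
  refine PBW.Act_lie b s.B _ s.skew s.leib s.self ?_ x y v
  intro h h'
  have := p.br_span (p.h2 h) (p.h2 h')
  have e := p.ac_span this.1
  rw [this.2, zero_smul] at e
  exact e

lemma lie2 (x y : X) : p.ac (s.B x y) = p.ac x ∘ₗ p.ac y - p.ac y ∘ₗ p.ac x := by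
  refine LinearMap.ext fun v => ?_
  rw [LinearMap.sub_apply, LinearMap.comp_apply, LinearMap.comp_apply, p.lie x y v]
  abel

lemma gen (T : Submodule K p.V) (hT : ∀ x, ∀ v ∈ T, p.ac x v ∈ T) (h0 : p.vac ∈ T) : T = ⊤ :=
  PBW.gen b s.B _ T h0 hT

lemma level : p.ac s.eK = s.cc ℓ • LinearMap.id := by
  have := p.gen (LinearMap.eqLocus (p.ac s.eK) (s.cc ℓ • LinearMap.id)) (by
    intro x v hv
    have hv' : p.ac s.eK v = s.cc ℓ • v := hv
    show p.ac s.eK (p.ac x v) = s.cc ℓ • (p.ac x v)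
    rw [p.lie, hv', s.hkl]; simp) (by
    show p.ac s.eK p.vac = s.cc ℓ • p.vac
    rw [p.ac_span genK, p.hχK])
  refine LinearMap.ext fun v => ?_
  have hv : v ∈ LinearMap.eqLocus (p.ac s.eK) (s.cc ℓ • LinearMap.id) := by
    rw [this]; trivial
  exact hv

lemma annA (a : g) {n : ℤ} (hn : 0 ≤ n) : p.ac (s.AA n a) p.vac = 0 := by
  rw [p.ac_span (genA a hn), p.hχA, zero_smul]
lemma annB (a : g) {n : ℤ} (hn : 0 ≤ n) : p.ac (s.BB n a) p.vac = 0 := by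
  rw [p.ac_span (genB a hn), p.hχB, zero_smul]

lemma inj {x : X} (hx : x ∈ Submodule.span K (Set.range fun j => b (Sum.inl j)))
    (h : p.ac x p.vac = 0) : x = 0 := by
  obtain ⟨c, rfl⟩ := (Finsupp.mem_span_range_iff_exists_finsupp).1 hx
  have e : ∀ j, p.ac (b (Sum.inl j)) p.vac = Finsupp.single ({j} : Multiset J) (1 : K) :=
    fun j => PBW.Act_R1 b s.B _ j 0 (by simp)
  have hc : c = 0 := by
    ext j
    have h2 := congrArg (fun v : PBW.S K J => v {j}) h
    classical
    rw [Finsupp.sum, map_sum, LinearMap.sum_apply] at h2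
    simp only [map_smul, LinearMap.smul_apply, e, Finsupp.finsetSum_apply, Finsupp.smul_apply,
      Finsupp.single_apply, Multiset.singleton_inj] at h2
    simpa using h2
  simp [hc]

section univ
variable {W : Type} [AddCommGroup W] [Module K W] (ρ : X →ₗ[K] W →ₗ[K] W) (w₀ : W)

lemma univ (hρ : ∀ x y, ρ (s.B x y) = ρ x ∘ₗ ρ y - ρ y ∘ₗ ρ x)
  (hk : ρ s.eK w₀ = s.cc ℓ • w₀)
  (hwA : ∀ a n, 0 ≤ n → ρ (s.AA n a) w₀ = 0)
  (hwB : ∀ a n, 0 ≤ n → ρ (s.BB n a) w₀ = 0) :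
    ∃! ψ : p.V →ₗ[K] W, ψ p.vac = w₀ ∧ ∀ x v, ψ (p.ac x v) = ρ x (ψ v) := by
  refine ⟨PBW.psi b ρ w₀, ⟨PBW.psi_zero b ρ w₀, ?_⟩, ?_⟩
  · intro x v
    refine PBW.psi_hom b s.B _ ρ w₀ hρ ?_ x v
    intro h
    have key : Submodule.span K s.Gn ≤ LinearMap.eqLocus (ρ.flip w₀)
      (LinearMap.toSpanSingleton K _ w₀ ∘ₗ p.χ) := by
      refine Submodule.span_le.2 ?_
      rintro _ (⟨a, m, hm, rfl⟩ | ⟨a, m, hm, rfl⟩ | rfl)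
      · simp [hwA a m hm, p.hχA]
      · simp [hwB a m hm, p.hχB]
      · simp [hk, p.hχK]
    simpa using key (p.h2 h)
  · rintro ψ ⟨h0, h⟩
    have := p.gen (LinearMap.eqLocus ψ (PBW.psi b ρ w₀)) (by
      intro x v hv
      have hv' : ψ v = PBW.psi b ρ w₀ v := hv
      show ψ (p.ac x v) = PBW.psi b ρ w₀ (p.ac x v)
      rw [h, hv']
      symm
      refine PBW.psi_hom b s.B _ ρ w₀ hρ ?_ x v
      intro h
      have key : Submodule.span K s.Gn ≤ LinearMap.eqLocus (ρ.flip w₀)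
        (LinearMap.toSpanSingleton K _ w₀ ∘ₗ p.χ) := by
        refine Submodule.span_le.2 ?_
        rintro _ (⟨a, m, hm, rfl⟩ | ⟨a, m, hm, rfl⟩ | rfl)
        · simp [hwA a m hm, p.hχA]
        · simp [hwB a m hm, p.hχB]
        · simp [hk, p.hχK]
      simpa using key (p.h2 h)) (by
      show ψ p.vac = PBW.psi b ρ w₀ p.vac
      rw [h0]; exact (PBW.psi_zero b ρ w₀).symm)
    refine LinearMap.ext fun v => ?_
    have hv : v ∈ LinearMap.eqLocus ψ (PBW.psi b ρ w₀) := by rw [this]; trivial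
    exact hv

end univ

end Pol

/-- doubled space -/
def Dbl (_s : Setup g K X) (V : Type) : Type := V × V

section
variable {V : Type} [AddCommGroup V] [Module K V]

instance : AddCommGroup (s.Dbl V) := inferInstanceAs (AddCommGroup (V × V))

def pr (v w : V) : s.Dbl V := (v, w)

@[simp] lemma pr_1 (v w : V) : (s.pr v w).1 = v := rfl
@[simp] lemma pr_2 (v w : V) : (s.pr v w).2 = w := rfl

lemma Dext {x y : s.Dbl V} (h1 : x.1 = y.1) (h2 : x.2 = y.2) : x = y := Prod.ext h1 h2

@[simp] lemma add_1 (x y : s.Dbl V) : (x + y).1 = x.1 + y.1 := rfl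
@[simp] lemma add_2 (x y : s.Dbl V) : (x + y).2 = x.2 + y.2 := rfl
@[simp] lemma sub_1 (x y : s.Dbl V) : (x - y).1 = x.1 - y.1 := rfl
@[simp] lemma sub_2 (x y : s.Dbl V) : (x - y).2 = x.2 - y.2 := rfl
@[simp] lemma zero_1 : (0 : s.Dbl V).1 = 0 := rfl
@[simp] lemma zero_2 : (0 : s.Dbl V).2 = 0 := rfl

instance : SMul K (s.Dbl V) := ⟨fun f x => s.pr (f • x.1) (f • x.2 + s.dL f • x.1)⟩

@[simp] lemma smul_1 (f : K) (x : s.Dbl V) : (f • x).1 = f • x.1 := rfl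
@[simp] lemma smul_2 (f : K) (x : s.Dbl V) : (f • x).2 = f • x.2 + s.dL f • x.1 := rfl

lemma dL_one : s.dL 1 = 0 := by rw [← map_one s.cc, s.dL_cc]

instance : Module K (s.Dbl V) where
  one_smul x := s.Dext (by simp) (by simp [dL_one])
  mul_smul f h x := s.Dext (by simp [mul_smul]) (by simp [s.dL_mul]; module)
  smul_zero f := s.Dext (by simp) (by simp)
  smul_add f x y := s.Dext (by simp) (by simp; abel)
  add_smul f h x := s.Dext (by simp [add_smul]) (by simp [add_smul]; abel)
  zero_smul x := s.Dext (by simp) (by simp)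

def Dρ (ρ : X →ₗ[K] V →ₗ[K] V) : X →ₗ[K] s.Dbl V →ₗ[K] s.Dbl V :=
  LinearMap.mk₂ K (fun x u => s.pr (ρ x u.1) (ρ x u.2 + ρ (s.d x) u.1))
    (fun x y u => s.Dext (by simp) (by simp; abel))
    (fun f x u => s.Dext (by simp) (by simp [s.d_smul]; module))
    (fun x u w => s.Dext (by simp) (by simp; abel))
    (fun f x u => s.Dext (by simp) (by simp; module))

@[simp] lemma Dρ_1 (ρ : X →ₗ[K] V →ₗ[K] V) (x : X) (u : s.Dbl V) :
  (s.Dρ ρ x u).1 = ρ x u.1 := rfl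
@[simp] lemma Dρ_2 (ρ : X →ₗ[K] V →ₗ[K] V) (x : X) (u : s.Dbl V) :
  (s.Dρ ρ x u).2 = ρ x u.2 + ρ (s.d x) u.1 := rfl

lemma Dρ_lie (ρ : X →ₗ[K] V →ₗ[K] V) (hρ : ∀ x y, ρ (s.B x y) = ρ x ∘ₗ ρ y - ρ y ∘ₗ ρ x)
    (x y : X) : s.Dρ ρ (s.B x y) = s.Dρ ρ x ∘ₗ s.Dρ ρ y - s.Dρ ρ y ∘ₗ s.Dρ ρ x := by
  refine LinearMap.ext fun u => ?_
  refine s.Dext ?_ ?_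
  · simp [hρ]
  · simp [hρ, s.d_der]; abel
end

namespace Pol
variable {J H : Type} [LinearOrder J] {b : Module.Basis (J ⊕ H) K X} {ℓ : ℂ} {s}
  (p : s.Pol b ℓ)

theorem exD : ∃ D : p.V →+ p.V, D p.vac = 0 ∧ (∀ (f : K) v, D (f • v) = s.dL f • v + f • D v) ∧
    ∀ x v, D (p.ac x v) = p.ac x (D v) + p.ac (s.d x) v := by
  obtain ⟨ψ, ⟨h0, h⟩, -⟩ := p.univ (s.Dρ p.ac) (s.pr p.vac 0) (s.Dρ_lie p.ac p.lie2)
    (s.Dext (by simp [p.level]) (by simp [s.d_K, s.dL_cc]))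
    (fun a n hn => s.Dext (by simp [p.annA a hn]) (by
      rcases hn.eq_or_lt with rfl | hn
      · simp [s.dA]
      · simp [s.dA, p.annA a (show 0 ≤ n - 1 by omega)]))
    (fun a n hn => s.Dext (by simp [p.annB a hn]) (by
      rcases hn.eq_or_lt with rfl | hn
      · simp [s.dB]
      · simp [s.dB, p.annB a (show 0 ≤ n - 1 by omega)]))
  let π : p.V →ₗ[K] p.V := ⟨⟨fun v => (ψ v).1, fun v w => by simp⟩, fun f v => by simp⟩
  have hπ : LinearMap.eqLocus π LinearMap.id = ⊤ := by
    apply p.gen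
    · intro x v hv
      have hv' : (ψ v).1 = v := hv
      show (ψ (p.ac x v)).1 = p.ac x v
      rw [h, Dρ_1, hv']
    · show (ψ p.vac).1 = p.vac
      rw [h0]; rfl
  have h1 : ∀ v, (ψ v).1 = v := by
    intro v
    have hv : v ∈ LinearMap.eqLocus π LinearMap.id := by rw [hπ]; trivial
    exact hv
  refine ⟨⟨⟨fun v => (ψ v).2, by simp⟩, fun v w => by simp⟩, ?_, ?_, ?_⟩
  · show (ψ p.vac).2 = 0
    rw [h0]; rfl
  · intro f v
    show (ψ (f • v)).2 = s.dL f • v + f • (ψ v).2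
    rw [map_smul, smul_2, h1, add_comm]
  · intro x v
    show (ψ (p.ac x v)).2 = p.ac x (ψ v).2 + p.ac (s.d x) v
    rw [h, Dρ_2, h1]

end Pol
end Setup
end VacMod

set_option linter.unusedSectionVars false
set_option linter.unusedSimpArgs false
namespace VacMod

section basis
variable {K T ι : Type} [CommRing K] [AddCommGroup T] [Module K T] (bT : Module.Basis ι K T)

abbrev JJ (ι : Type) := ℕ × ι
abbrev HH (ι : Type) := (ℕ × ι) ⊕ Unit

def eqv (ι : Type) : ((_ : ℤ) × ι) ⊕ Unit ≃ JJ ι ⊕ HH ι :=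
  (Equiv.sumCongr (((Equiv.sigmaEquivProd ℤ ι).trans
    (Equiv.prodCongr (Equiv.intEquivNatSumNat.trans (Equiv.sumComm _ _)) (Equiv.refl ι))).trans
    (Equiv.sumProdDistrib ℕ ℕ ι)) (Equiv.refl Unit)).trans (Equiv.sumAssoc _ _ _)

def bas : Module.Basis (JJ ι ⊕ HH ι) K ((ℤ →₀ T) × K) :=
  ((Finsupp.basis (fun _ : ℤ => bT)).prod (Module.Basis.singleton Unit K)).reindex (eqv ι)

lemma bas_1 (k : ℕ) (i : ι) : bas bT (Sum.inl (k, i)) = (Finsupp.single (Int.negSucc k) (bT i), 0) := by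
  have : (eqv ι).symm (Sum.inl (k, i)) = Sum.inl ⟨Int.negSucc k, i⟩ := by
    rw [Equiv.symm_apply_eq]; rfl
  rw [bas, Module.Basis.reindex_apply, this]
  refine Prod.ext ?_ ?_ <;> simp

lemma bas_2 (k : ℕ) (i : ι) :
    bas bT (Sum.inr (Sum.inl (k, i))) = (Finsupp.single (k : ℤ) (bT i), 0) := by
  have : (eqv ι).symm (Sum.inr (Sum.inl (k, i))) = Sum.inl ⟨(k : ℤ), i⟩ := by
    rw [Equiv.symm_apply_eq]; rfl
  rw [bas, Module.Basis.reindex_apply, this]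
  refine Prod.ext ?_ ?_ <;> simp

lemma bas_3 : bas bT (Sum.inr (Sum.inr ())) = (0, 1) := by
  have : (eqv ι).symm (Sum.inr (Sum.inr ())) = Sum.inr () := by
    rw [Equiv.symm_apply_eq]; rfl
  rw [bas, Module.Basis.reindex_apply, this]
  refine Prod.ext ?_ ?_ <;> simp

/-- `t ↦ (t ⊗ tⁿ, 0)` -/
def inn (K : Type) {T : Type} [CommRing K] [AddCommGroup T] [Module K T] (n : ℤ) :
    T →ₗ[K] (ℤ →₀ T) × K := LinearMap.inl K _ _ ∘ₗ Finsupp.lsingle n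

lemma inn_apply (n : ℤ) (t : T) : inn K n t = (Finsupp.single n t, 0) := rfl

lemma inn_mem {n : ℤ} {Q : Submodule K ((ℤ →₀ T) × K)} (h : ∀ i, inn K n (bT i) ∈ Q) (t : T) :
    inn K n t ∈ Q := by
  have : (⊤ : Submodule K T) ≤ Q.comap (inn K n) := by
    rw [← bT.span_eq, Submodule.span_le]
    rintro _ ⟨i, rfl⟩
    exact h i
  exact this trivial

end basis

section dd
variable {K T : Type} [CommRing K] [AddCommGroup T] [Module K T] (cc : ℂ →+* K)
  (dL : K →+ K) (dT : T →+ T)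

def dF : (ℤ →₀ T) →+ (ℤ →₀ T) := Finsupp.liftAddHom fun n =>
  (Finsupp.singleAddHom n).comp dT -
    (Finsupp.singleAddHom (n - 1)).comp (DistribSMul.toAddMonoidHom T (cc n))

lemma dF_single (n : ℤ) (t : T) : dF cc dT (Finsupp.single n t) =
    Finsupp.single n (dT t) - cc n • Finsupp.single (n - 1) t := by
  simp [dF]

def dd : (ℤ →₀ T) × K →+ (ℤ →₀ T) × K := (dF cc dT).prodMap dL

lemma dd_smul (h : ∀ (f : K) t, dT (f • t) = dL f • t + f • dT t)
    (hL : ∀ f h, dL (f * h) = dL f * h + f * dL h) (f : K) (x : (ℤ →₀ T) × K) :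
    dd cc dL dT (f • x) = dL f • x + f • dd cc dL dT x := by
  refine Prod.ext ?_ ?_
  · show dF cc dT (f • x.1) = dL f • x.1 + f • dF cc dT x.1
    induction x.1 using Finsupp.induction_linear with
    | zero => simp
    | add u v hu hv => simp only [smul_add, map_add, hu, hv]; abel
    | single n t =>
      rw [Finsupp.smul_single, dF_single, dF_single, h, Finsupp.single_add,
        ← Finsupp.smul_single, ← Finsupp.smul_single, ← Finsupp.smul_single]
      module
  · exact hL f x.2

lemma dd_inn (n : ℤ) (t : T) : dd cc dL dT (inn K n t) = inn K n (dT t) - cc n • inn K (n - 1) t := by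
  refine Prod.ext ?_ ?_
  · exact dF_single cc dT n t
  · simp [dd, inn]
end dd

section main
variable {K T ι : Type} [CommRing K] [AddCommGroup T] [Module K T]

theorem gen_main (bT : Module.Basis ι K T) (cc : ℂ →+* K) (dL : K →+ K)
    (dL_mul : ∀ f h, dL (f * h) = dL f * h + f * dL h) (dL_cc : ∀ c, dL (cc c) = 0)
    (N : ℕ) (q : ℕ → K) (q_top : q (N + 1) = 0)
    (q_deriv : ∀ j : ℕ, dL (q j) = cc ((j : ℂ) + 1) * q (j + 1))
    (hD : ℤ → K) (hD_deriv : ∀ i : ℤ, dL (hD i) = cc ((i : ℂ) + 1) * hD (i + 1))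
    (hD_neg : ∀ i : ℤ, i < 0 → hD i = 0)
    (hD_sum : ∀ t : ℤ, (∑ j ∈ Finset.range (N + 1), if t + (j : ℤ) = 0 then q j else 0) = hD (-t))
    (Φ : g →ₗ[ℂ] g →ₗ[ℂ] ℂ) (hsymm : ∀ a b : g, Φ a b = Φ b a)
    (hinv : ∀ a b c : g, Φ ⁅a, b⁆ c = Φ a ⁅b, c⁆)
    (u : g × g → T) (u_add : ∀ x y, u (x + y) = u x + u y)
    (u_span : ∀ Q : Submodule K T, (∀ x, u x ∈ Q) → ∀ t, t ∈ Q)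
    (dT : T →+ T) (dT_smul : ∀ (f : K) t, dT (f • t) = dL f • t + f • dT t)
    (dT_u : ∀ x, dT (u x) = 0)
    (eA eB : g → ℤ → (ℤ →₀ T) × K) (eK : (ℤ →₀ T) × K)
    (eA_def : ∀ a n, eA a n = (Finsupp.single n (u (a, 0)), 0))
    (eB_def : ∀ a n, eB a n = (Finsupp.single n (u (0, a)), 0))
    (eK_def : eK = (0, 1))
    (B : (ℤ →₀ T) × K →ₗ[K] (ℤ →₀ T) × K →ₗ[K] (ℤ →₀ T) × K)
    (hkl : ∀ x, B eK x = 0) (hkr : ∀ x, B x eK = 0)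
    (haa : ∀ (a b : g) (m n : ℤ), B (eA a m) (eA b n) = eA ⁅a, b⁆ (m + n) +
      (if m + n = 0 then cc (m * Φ a b) else 0) • eK)
    (hab : ∀ (a b : g) (m n : ℤ), B (eA a m) (eB b n) = eB ⁅a, b⁆ (m + n))
    (hba : ∀ (a b : g) (m n : ℤ), B (eB a m) (eA b n) = eB ⁅a, b⁆ (m + n))
    (hbb : ∀ (a b : g) (m n : ℤ), B (eB a m) (eB b n) =
      (∑ j ∈ Finset.range (N + 1), q j • eA ⁅a, b⁆ (m + n + (j : ℤ)))
        + (cc ((1 / 2 : ℂ) * ((m : ℂ) - (n : ℂ)) * Φ a b) * hD (-m - n)) • eK)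
    (ℓ : ℂ) :
    ∃ (V : Type) (_ : AddCommGroup V) (_ : Module K V)
      (ρ : (ℤ →₀ T) × K →ₗ[K] V →ₗ[K] V) (one : V),
      (∀ x y, ρ (B x y) = ρ x ∘ₗ ρ y - ρ y ∘ₗ ρ x) ∧
      (ρ eK = cc ℓ • LinearMap.id) ∧
      (∀ (f : K) (a : g) (n : ℤ), 0 ≤ n → ρ (f • eA a n) one = 0 ∧ ρ (f • eB a n) one = 0) ∧
      (∀ S : Submodule K V, (∀ x, ∀ v ∈ S, ρ x v ∈ S) → one ∈ S → S = ⊤) ∧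
      (∃ D : V →+ V, D one = 0 ∧ (∀ (c : ℂ) (v : V), D (cc c • v) = cc c • D v) ∧
        (∀ (f : K) (v : V), D (f • v) = dL f • v + f • D v) ∧
        (∀ (f : K) (a : g) (n : ℤ) (v : V),
          D (ρ (f • eA a n) v) - ρ (f • eA a n) (D v)
            = ρ (dL f • eA a n) v - cc n • ρ (f • eA a (n - 1)) v) ∧
        (∀ (f : K) (a : g) (n : ℤ) (v : V),
          D (ρ (f • eB a n) v) - ρ (f • eB a n) (D v)
            = ρ (dL f • eB a n) v - cc n • ρ (f • eB a (n - 1)) v)) ∧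
      (Function.Injective fun t : T => ρ (Finsupp.single (-1 : ℤ) t, 0) one) ∧
      (∀ (W : Type) [AddCommGroup W] [Module K W] (σ : (ℤ →₀ T) × K →ₗ[K] W →ₗ[K] W),
        (∀ x y, σ (B x y) = σ x ∘ₗ σ y - σ y ∘ₗ σ x) →
        (σ eK = cc ℓ • LinearMap.id) →
        ∀ w₀ : W,
          (∀ (f : K) (a : g) (n : ℤ), 0 ≤ n → σ (f • eA a n) w₀ = 0 ∧ σ (f • eB a n) w₀ = 0) →
          ∃! ψ : V →ₗ[K] W, ψ one = w₀ ∧ ∀ x (v : V), ψ (ρ x v) = σ x (ψ v)) := by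
  have eA' : ∀ a n, eA a n = inn K n (u (a, 0)) := eA_def
  have eB' : ∀ a n, eB a n = inn K n (u (0, a)) := eB_def
  have hu : ∀ x : g × g, u x = u (x.1, 0) + u (0, x.2) := by
    intro x; rw [← u_add]; simp
  have hinn : ∀ n (Q : Submodule K ((ℤ →₀ T) × K)), (∀ a, eA a n ∈ Q) → (∀ a, eB a n ∈ Q) →
      ∀ t, inn K n t ∈ Q := by
    intro n Q hA hB t
    refine u_span (Q.comap (inn K n)) ?_ t
    intro x
    rw [hu]
    refine Submodule.add_mem _ ?_ ?_
    · show inn K n _ ∈ Q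
      rw [← eA']; exact hA _
    · show inn K n _ ∈ Q
      rw [← eB']; exact hB _
  let s : Setup g K ((ℤ →₀ T) × K) :=
    { cc := cc, dL := dL, dL_mul := dL_mul, dL_cc := dL_cc, N := N, q := q, q_top := q_top,
      q_deriv := q_deriv, hD := hD, hD_deriv := hD_deriv, hD_neg := hD_neg, hD_sum := hD_sum,
      Φ := Φ, hsymm := hsymm, hinv := hinv, eA := eA, eB := eB, eK := eK
      eA_add := by
        intro a b n
        rw [eA', eA', eA', ← map_add, ← u_add]; simp
      eB_add := by
        intro a b n
        rw [eB', eB', eB', ← map_add, ← u_add]; simp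
      ind := by
        intro Q hA hB hK x
        have h1 : ∀ F : ℤ →₀ T, ((F, 0) : (ℤ →₀ T) × K) ∈ Q := by
          intro F
          induction F using Finsupp.induction_linear with
          | zero => exact Q.zero_mem
          | add x y hx hy => simpa using Q.add_mem hx hy
          | single n t => exact hinn n Q (fun a => hA a n) (fun a => hB a n) t
        have e : x = (x.1, 0) + x.2 • eK := by
          rw [eK_def]; refine Prod.ext ?_ ?_ <;> simp
        rw [e]
        exact Q.add_mem (h1 _) (Q.smul_mem _ hK)
      B := B, hkl := hkl, hkr := hkr, haa := haa, hab := hab, hba := hba, hbb := hbb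
      d := dd cc dL dT
      d_smul := dd_smul cc dL dT dT_smul dL_mul
      d_A := by intro a n; rw [eA', eA', dd_inn, dT_u]; simp
      d_B := by intro a n; rw [eB', eB', dd_inn, dT_u]; simp
      d_K := by
        rw [eK_def]
        refine Prod.ext ?_ ?_
        · simp [dd]
        · have := dL_cc 1
          rw [map_one] at this
          simp [dd, this] }
  let _ : LinearOrder (JJ ι) := by
    classical
    exact linearOrderOfSTO (WellOrderingRel (α := JJ ι))
  have hH : ∀ k t, inn K (k : ℕ) t ∈
      (Submodule.span K (Set.range fun h => bas bT (Sum.inr h)) : Submodule K ((ℤ →₀ T) × K)) := by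
    intro k t
    refine inn_mem bT ?_ t
    intro i
    refine Submodule.subset_span ⟨Sum.inl (k, i), ?_⟩
    rw [inn_apply]; exact bas_2 bT k i
  let p : s.Pol (bas bT) ℓ :=
    { χ := cc ℓ • LinearMap.snd K _ _
      hχA := by
        intro a n
        show cc ℓ * (eA a n).2 = 0
        rw [eA_def, mul_zero]
      hχB := by
        intro a n
        show cc ℓ * (eB a n).2 = 0
        rw [eB_def, mul_zero]
      hχK := by
        show cc ℓ * eK.2 = cc ℓ
        rw [eK_def, mul_one]
      h1 := by
        rintro x (⟨a, n, hn, rfl⟩ | ⟨a, n, hn, rfl⟩ | hx)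
        · show eA a n ∈ Submodule.span K _
          lift n to ℕ using hn
          rw [eA']; exact hH _ _
        · show eB a n ∈ Submodule.span K _
          lift n to ℕ using hn
          rw [eB']; exact hH _ _
        · refine Submodule.subset_span ⟨Sum.inr (), ?_⟩
          have hx2 : x = eK := hx
          rw [hx2, eK_def]; exact bas_3 bT
      h2 := by
        rintro (⟨k, i⟩ | ⟨⟩)
        · rw [bas_2]
          refine hinn k _ ?_ ?_ (bT i)
          · intro a; exact Setup.Pol.genA (s := s) a (by omega)
          · intro a; exact Setup.Pol.genB (s := s) a (by omega)
        · rw [bas_3, ← eK_def]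
          exact Setup.Pol.genK (s := s) }
  refine ⟨p.V, inferInstance, inferInstance, p.ac, p.vac, p.lie2, p.level, ?_, p.gen, ?_, ?_, ?_⟩
  · intro f a n hn
    rw [map_smul, map_smul]
    exact ⟨by rw [LinearMap.smul_apply]; erw [p.annA a hn]; exact smul_zero _,
      by rw [LinearMap.smul_apply]; erw [p.annB a hn]; exact smul_zero _⟩
  · obtain ⟨D, h0, h1, h2⟩ := p.exD
    refine ⟨D, h0, ?_, h1, ?_, ?_⟩
    · intro c v
      rw [h1]
      show dL (cc c) • v + _ = _
      rw [dL_cc, zero_smul, zero_add]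
    · intro f a n v
      rw [h2, s.d_smul, show s.d (eA a n) = _ from s.d_A a n]
      show _ + p.ac (dL f • eA a n + f • -(cc n • eA a (n - 1))) v - _ = _
      simp only [map_add, map_smul, map_neg, LinearMap.add_apply, LinearMap.smul_apply,
        LinearMap.neg_apply]
      module
    · intro f a n v
      rw [h2, s.d_smul, show s.d (eB a n) = _ from s.d_B a n]
      show _ + p.ac (dL f • eB a n + f • -(cc n • eB a (n - 1))) v - _ = _
      simp only [map_add, map_smul, map_neg, LinearMap.add_apply, LinearMap.smul_apply,
        LinearMap.neg_apply]
      module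
  · intro t t' h
    have h' : p.ac (inn K (-1) t) p.vac = p.ac (inn K (-1) t') p.vac := h
    have hm : inn K (-1) (t - t') ∈ Submodule.span K (Set.range fun j => bas bT (Sum.inl j)) := by
      refine inn_mem bT ?_ _
      intro i
      refine Submodule.subset_span ⟨(0, i), ?_⟩
      rw [inn_apply]; exact bas_1 bT 0 i
    have := p.inj hm (by rw [map_sub, map_sub, LinearMap.sub_apply, h', sub_self])
    rw [inn_apply] at this
    have h3 := congrArg Prod.fst this
    have h4 : t - t' = 0 := Finsupp.single_eq_zero.1 h3
    exact sub_eq_zero.1 h4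
  · intro W _ _ σ hσ hk w₀ hw
    refine p.univ σ w₀ hσ ?_ ?_ ?_
    · show σ eK w₀ = cc ℓ • w₀
      rw [hk]; rfl
    · intro a n hn
      have := (hw 1 a n hn).1
      rw [one_smul] at this; exact this
    · intro a n hn
      have := (hw 1 a n hn).2
      rw [one_smul] at this; exact this

end main
end VacMod

namespace VacMod

lemma csmul (c : ℂ) (x : CpSp g) : c • x = (algebraMap ℂ (LaurentSeries ℂ) c) • x := by
  rw [algMap_eq]
  have hT : ∀ t : LaurentSeries ℂ ⊗[ℂ] (g × g), c • t = (HahnSeries.C c : LaurentSeries ℂ) • t := by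
    intro t
    induction t using TensorProduct.induction_on with
    | zero => simp
    | tmul f u => 
      rw [TensorProduct.smul_tmul', TensorProduct.smul_tmul', smul_eq_mul, HahnSeries.C_mul_eq_smul]
    | add x y hx hy => rw [smul_add, smul_add, hx, hy]
  refine Prod.ext ?_ ?_
  · ext n
    exact hT _
  · show c • x.2 = (HahnSeries.C c : LaurentSeries ℂ) * x.2
    rw [HahnSeries.C_mul_eq_smul]

def dLs : LaurentSeries ℂ →+ LaurentSeries ℂ :=
  ⟨⟨fun f => LSderiv f, map_zero _⟩, fun f h => map_add _ f h⟩

def dTs (g : Type) [LieRing g] [LieAlgebra ℂ g] :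
    LaurentSeries ℂ ⊗[ℂ] (g × g) →+ LaurentSeries ℂ ⊗[ℂ] (g × g) :=
  (LinearMap.rTensor (g × g) (LaurentSeries.derivative ℂ :
    LaurentSeries ℂ →ₗ[ℂ] LaurentSeries ℂ)).toAddMonoidHom

lemma dTs_tmul (f : LaurentSeries ℂ) (x : g × g) : dTs g (f ⊗ₜ[ℂ] x) = (LSderiv f) ⊗ₜ[ℂ] x := rfl

lemma dTs_smul (f : LaurentSeries ℂ) (t : LaurentSeries ℂ ⊗[ℂ] (g × g)) :
    dTs g (f • t) = LSderiv f • t + f • dTs g t := by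
  induction t using TensorProduct.induction_on with
  | zero => rw [smul_zero, smul_zero, map_zero, smul_zero, add_zero]
  | tmul h x =>
    rw [TensorProduct.smul_tmul', TensorProduct.smul_tmul', dTs_tmul, dTs_tmul,
      TensorProduct.smul_tmul', smul_eq_mul, smul_eq_mul, smul_eq_mul, deriv_mul,
      TensorProduct.add_tmul]
  | add x y hx hy =>
    rw [smul_add, smul_add, map_add, map_add, smul_add, hx, hy]
    exact add_add_add_comm _ _ _ _

lemma us_span (Q : Submodule (LaurentSeries ℂ) (LaurentSeries ℂ ⊗[ℂ] (g × g)))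
    (h : ∀ x : g × g, (1 : LaurentSeries ℂ) ⊗ₜ[ℂ] x ∈ Q) (t : LaurentSeries ℂ ⊗[ℂ] (g × g)) :
    t ∈ Q := by
  induction t using TensorProduct.induction_on with
  | zero => exact Q.zero_mem
  | tmul f x =>
    have := Q.smul_mem f (h x)
    rwa [TensorProduct.smul_tmul', smul_eq_mul, mul_one] at this
  | add x y hx hy => exact Q.add_mem hx hy

def toC (M : CheckRep g) (D : M.V →+ M.V) (h : ∀ (c : ℂ) (v : M.V),
    D (algebraMap ℂ (LaurentSeries ℂ) c • v) = algebraMap ℂ (LaurentSeries ℂ) c • D v) :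
    M.V →ₗ[ℂ] M.V :=
  { toFun := fun v => D v, map_add' := fun v w => map_add D v w, map_smul' := fun c v => h c v }

end VacMod


set_option maxHeartbeats 1000000 in
theorem statement15
    (Φ : g →ₗ[ℂ] g →ₗ[ℂ] ℂ)
    (hsymm : ∀ a b : g, Φ a b = Φ b a)
    (hinv : ∀ a b c : g, Φ ⁅a, b⁆ c = Φ a ⁅b, c⁆)
    (hnondeg : ∀ a : g, (∀ b : g, Φ a b = 0) → a = 0)
    (P : Polynomial ℂ)
    -- the ℂ((z))-bilinear bracket of `ǧ_p`, specified on the generating elements: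
    (B : CpSp g →ₗ[LaurentSeries ℂ] CpSp g →ₗ[LaurentSeries ℂ] CpSp g)
    -- `k` is central:
    (hkl : ∀ x : CpSp g, B (elCK g) x = 0)
    (hkr : ∀ x : CpSp g, B x (elCK g) = 0)
    -- `[a⊗tᵐ, b⊗tⁿ] = [a,b]⊗tᵐ⁺ⁿ + m⟨a,b⟩δ_{m+n,0}k`:
    (haa : ∀ (a b : g) (m n : ℤ),
      B (elCA a m) (elCA b n)
        = elCA ⁅a, b⁆ (m + n)
          + (if m + n = 0 then ((m : ℂ) * Φ a b) • elCK g else 0))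
    -- `[a⊗tᵐ, b¹⊗tⁿ] = [a¹⊗tᵐ, b⊗tⁿ] = [a,b]¹⊗tᵐ⁺ⁿ`:
    (hab : ∀ (a b : g) (m n : ℤ), B (elCA a m) (elCB b n) = elCB ⁅a, b⁆ (m + n))
    (hba : ∀ (a b : g) (m n : ℤ), B (elCB a m) (elCA b n) = elCB ⁅a, b⁆ (m + n))
    -- `[a¹⊗tᵐ, b¹⊗tⁿ] = Σ_{j≥0} (p^{(j)}(z)/j!)[a,b]⊗tᵐ⁺ⁿ⁺ʲ
    --                  + (1/2)(m−n)⟨a,b⟩(p^{(−m−n)}(z)/(−m−n)!)k`: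
    (hbb : ∀ (a b : g) (m n : ℤ),
      B (elCB a m) (elCB b n)
        = (∑ j ∈ Finset.range (P.natDegree + 1),
            polyToL (Polynomial.hasseDeriv j P) • elCA ⁅a, b⁆ (m + n + (j : ℤ)))
          + ((1 / 2 : ℂ) * ((m : ℂ) - (n : ℂ)) * Φ a b) • (hDiv P (-m - n) • elCK g))
    (ℓ : ℂ) :
    -- there is a `ǧ_p`-module `V` (with Lie action w.r.t. the bracket `B`) ...
    ∃ (M : CheckRep g) (one : M.V),
      (∀ x y : CpSp g, M.ρ (B x y) = M.ρ x ∘ₗ M.ρ y - M.ρ y ∘ₗ M.ρ x) ∧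
      -- ... of level `ℓ`:
      (M.ρ (elCK g) = algebraMap ℂ (LaurentSeries ℂ) ℓ • LinearMap.id) ∧
      -- (a) the vacuum vector is annihilated by all `f(z)u⊗tⁿ`, `n ≥ 0`:
      (∀ (f : LaurentSeries ℂ) (a : g) (n : ℤ), 0 ≤ n →
        M.ρ (f • elCA a n) one = 0 ∧ M.ρ (f • elCB a n) one = 0) ∧
      -- (b) the only `ǧ_p`-submodule of `V` containing `1` is `V` itself:
      (∀ S : Submodule (LaurentSeries ℂ) M.V,
        (∀ x : CpSp g, ∀ v ∈ S, M.ρ x v ∈ S) → one ∈ S → S = ⊤) ∧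
      -- (c) a ℂ-linear operator `D` with `D1 = 0`, `D(f(z)v) = f'(z)v + f(z)Dv`, and
      --     `[D, ρ(f(z)u⊗tⁿ)] = ρ(f'(z)u⊗tⁿ) − n·ρ(f(z)u⊗tⁿ⁻¹)`:
      (∃ D : M.V →ₗ[ℂ] M.V, D one = 0 ∧
        (∀ (f : LaurentSeries ℂ) (v : M.V), D (f • v) = LSderiv f • v + f • D v) ∧
        (∀ (f : LaurentSeries ℂ) (a : g) (n : ℤ) (v : M.V),
          D (M.ρ (f • elCA a n) v) - M.ρ (f • elCA a n) (D v)
            = M.ρ (LSderiv f • elCA a n) v - (n : ℂ) • M.ρ (f • elCA a (n - 1)) v) ∧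
        (∀ (f : LaurentSeries ℂ) (a : g) (n : ℤ) (v : M.V),
          D (M.ρ (f • elCB a n) v) - M.ρ (f • elCB a n) (D v)
            = M.ρ (LSderiv f • elCB a n) v - (n : ℂ) • M.ρ (f • elCB a (n - 1)) v)) ∧
      -- (d) the `ℂ((z))`-linear map `ℂ((z))⊗(g⊕g¹) → V`, `f(z)u ↦ ρ(f(z)u⊗t⁻¹)1`,
      --     is injective:
      (Function.Injective fun u : LaurentSeries ℂ ⊗[ℂ] (g × g) =>
        M.ρ ((Finsupp.single (-1 : ℤ) u, 0) : CpSp g) one) ∧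
      -- (e) universality:
      (∀ N : CheckRep g,
        (∀ x y : CpSp g, N.ρ (B x y) = N.ρ x ∘ₗ N.ρ y - N.ρ y ∘ₗ N.ρ x) →
        (N.ρ (elCK g) = algebraMap ℂ (LaurentSeries ℂ) ℓ • LinearMap.id) →
        ∀ w₀ : N.V,
          (∀ (f : LaurentSeries ℂ) (a : g) (n : ℤ), 0 ≤ n →
            N.ρ (f • elCA a n) w₀ = 0 ∧ N.ρ (f • elCB a n) w₀ = 0) →
          ∃! ψ : M.V →ₗ[LaurentSeries ℂ] N.V,
            ψ one = w₀ ∧ ∀ (x : CpSp g) (v : M.V), ψ (M.ρ x v) = N.ρ x (ψ v)) := by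
  obtain ⟨V, i1, i2, ρ, one, h1, h2, h3, h4, h5, h6, h7⟩ :=
    VacMod.gen_main (g := g) (K := LaurentSeries ℂ) (T := LaurentSeries ℂ ⊗[ℂ] (g × g))
      (Module.Basis.ofVectorSpace (LaurentSeries ℂ) (LaurentSeries ℂ ⊗[ℂ] (g × g)))
      (algebraMap ℂ (LaurentSeries ℂ)) VacMod.dLs VacMod.deriv_mul
      (fun c => by
        have := VacMod.deriv_C c
        rw [← VacMod.algMap_eq] at this; exact this)
      P.natDegree (fun j => polyToL (Polynomial.hasseDeriv j P))
      (by
        show polyToL (Polynomial.hasseDeriv (P.natDegree + 1) P) = 0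
        rw [Polynomial.hasseDeriv_eq_zero_of_lt_natDegree P _ (Nat.lt_succ_self _)]
        exact map_zero _)
      (fun j => by rw [VacMod.algMap_eq]; exact VacMod.hasse_deriv P j)
      (hDiv P) (fun i => by rw [VacMod.algMap_eq]; exact VacMod.hDiv_deriv P i)
      (fun i hi => if_neg (by omega)) (VacMod.hDiv_sum P) Φ hsymm hinv
      (fun x => (1 : LaurentSeries ℂ) ⊗ₜ[ℂ] x) (fun x y => TensorProduct.tmul_add _ _ _)
      VacMod.us_span (VacMod.dTs g) VacMod.dTs_smul
      (fun x => by
        rw [VacMod.dTs_tmul]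
        have := VacMod.deriv_C 1
        rw [map_one] at this
        rw [this]; exact TensorProduct.zero_tmul _ _)
      elCA elCB (elCK g) (fun a n => rfl) (fun a n => rfl) rfl B hkl hkr
      (fun a b m n => by
        rw [haa]
        congr 1
        split_ifs
        · exact VacMod.csmul _ _
        · exact (zero_smul (LaurentSeries ℂ) (elCK g)).symm)
      hab hba
      (fun a b m n => by
        rw [hbb]
        congr 1
        rw [VacMod.csmul]
        exact (mul_smul (_ : LaurentSeries ℂ) (_ : LaurentSeries ℂ) (elCK g)).symm)
      ℓ
  obtain ⟨D, d0, d1, d2, d3, d4⟩ := h5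
  let M : CheckRep g := @CheckRep.mk g _ _ V i1 i2 ρ
  refine ⟨M, one, h1, h2, h3, h4,
    ⟨VacMod.toC M D d1, d0, d2, d3, d4⟩, h6, ?_⟩
  intro N hN hk w₀ hw
  exact h7 N.V N.ρ hN hk w₀ hw

end
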